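/- arXiv:1408.3908 — 2 statements merged into one kernel-verified Lean document; each statement's English description precedes it below -/
import Mathlib

section
/- Let λ : ℕ → [0,∞) be a sequence, let m : [0,∞) → [0,∞) satisfy m(x) ≥ μ₁ > 0 for every x ≥ 0 and |m(a) − m(b)| ≤ ω_m(|a−b|) for all a,b ≥ 0, where ω_m is a continuity modulus. Let σ ∈ (0,1/2] and δ > 0 be real numbers, and let α ∈ [0,1/4) satisfy limsup_{x→0⁺} (ω_m(x))^{4α} / x^{1−2σ} < +∞. Then there exists ε₀ > 0 (depending only on m, σ, δ, α) such that: whenever (u⁰,u¹) ∈ D(A^{α+1/2}) × D(A^α) satisfies |u¹|² + |A^{1/2}u⁰|² + |A^α u¹|² + |A^{α+1/2}u⁰|² ≤ ε₀, there exists a global solution on [0,+∞) of the Kirchhoff equation u'' + 2δ A^σ u' + m(|A^{1/2}u|²) A u = 0 with initial data (u⁰,u¹), belonging to C⁰([0,+∞), D(A^{α+1/2})) ∩ C¹([0,+∞), D(A^α)) (i.e. additionally the curves t ↦ (λ_k^{2α+1} u_k(t))_k and t ↦ (λ_k^{2α} u_k'(t))_k are continuous with values in ℓ²). -/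
open Set Filter MeasureTheory Topology

noncomputable section

/-- A continuity modulus: continuous on `[0,∞)`, vanishing at `0`, positive for positive
arguments, nondecreasing, and such that `x ↦ x / ω x` is nondecreasing on `(0,∞)`. -/
def IsModulus (ω : ℝ → ℝ) : Prop :=
  ContinuousOn ω (Ici 0) ∧ ω 0 = 0 ∧ (∀ x : ℝ, 0 < x → 0 < ω x) ∧
  (∀ x y : ℝ, 0 ≤ x → x ≤ y → ω x ≤ ω y) ∧
  (∀ x y : ℝ, 0 < x → x ≤ y → x / ω x ≤ y / ω y)

/-- The curve `t ↦ (v t k)_k` takes values in `ℓ²` and is continuous on `I`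
with respect to the `ℓ²` norm. -/
def L2Cont (I : Set ℝ) (v : ℝ → ℕ → ℝ) : Prop :=
  (∀ t ∈ I, Summable fun k => (v t k) ^ 2) ∧
  ∀ t ∈ I, ∀ ε : ℝ, 0 < ε → ∃ η > (0:ℝ), ∀ s ∈ I, |s - t| < η →
    (∑' k, (v s k - v t k) ^ 2) < ε

/-- A solution on the interval `I` (which contains `0`) of the Kirchhoff equation
`u'' + 2δ A^σ u' + m(|A^{1/2}u|²) A u = 0` with initial data `(u0, u1)`, in the diagonal
setting where `A` multiplies the `k`-th component by `lam k ^ 2`.  Each component is `C²`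
on `I`, satisfies the componentwise ODE, and the curves `t ↦ u(t)`, `t ↦ A^{1/2}u(t)`,
`t ↦ u'(t)` are continuous with values in `ℓ²`. -/
def IsKirchhoffSol (lam : ℕ → ℝ) (m : ℝ → ℝ) (σ δ : ℝ) (I : Set ℝ)
    (u0 u1 : ℕ → ℝ) (u : ℕ → ℝ → ℝ) : Prop :=
  (∀ k, ContDiffOn ℝ 2 (u k) I) ∧
  (∀ k, u k 0 = u0 k) ∧
  (∀ k, derivWithin (u k) I 0 = u1 k) ∧
  (∀ k, ∀ t ∈ I,
    derivWithin (derivWithin (u k) I) I t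
      + 2 * δ * lam k ^ (2 * σ) * derivWithin (u k) I t
      + m (∑' j, lam j ^ 2 * u j t ^ 2) * lam k ^ 2 * u k t = 0) ∧
  L2Cont I (fun t k => u k t) ∧
  L2Cont I (fun t k => lam k * u k t) ∧
  L2Cont I (fun t k => derivWithin (u k) I t)


lemma norm_integral_le_exp_abs {E : Type*} [NormedAddCommGroup E] [NormedSpace ℝ E]
    {g : ℝ → E} {C L : ℝ} (hC : 0 ≤ C) (hL : 0 < L)
    (hg : ∀ s, ‖g s‖ ≤ C * Real.exp (L * |s|)) (t : ℝ) :
    ‖∫ s in (0:ℝ)..t, g s‖ ≤ C / L * Real.exp (L * |t|) := by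
  have key : ∀ g : ℝ → E, (∀ s, ‖g s‖ ≤ C * Real.exp (L * |s|)) → ∀ t, 0 ≤ t →
      ‖∫ s in (0:ℝ)..t, g s‖ ≤ C / L * Real.exp (L * |t|) := by
    intro g hg t ht
    have hF : ∀ s ∈ uIcc 0 t,
        HasDerivAt (fun s => C / L * Real.exp (L * s)) (C * Real.exp (L * s)) s := by
      intro s _
      have h1 : HasDerivAt (fun s : ℝ => L * s) L s := by
        simpa using (hasDerivAt_id s).const_mul L
      refine (h1.exp.const_mul (C / L)).congr_deriv ?_
      field_simp
    have hgint : IntervalIntegrable (fun s => C * Real.exp (L * s)) volume 0 t :=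
      Continuous.intervalIntegrable (by fun_prop) _ _
    have h1 : ‖∫ s in (0:ℝ)..t, g s‖ ≤ ∫ s in (0:ℝ)..t, C * Real.exp (L * s) := by
      refine intervalIntegral.norm_integral_le_of_norm_le ht ?_ hgint
      refine Eventually.of_forall fun s hs => ?_
      have := hg s
      rwa [abs_of_pos hs.1] at this
    rw [intervalIntegral.integral_eq_sub_of_hasDerivAt hF hgint] at h1
    rw [abs_of_nonneg ht]
    have : 0 ≤ C / L * Real.exp (L * 0) := by positivity
    linarith
  rcases le_total 0 t with ht | ht
  · exact key g hg t ht
  · have h2 := key (fun s => g (-s)) (fun s => by simpa using hg (-s)) (-t) (by linarith)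
    rw [intervalIntegral.integral_comp_neg] at h2
    rw [intervalIntegral.integral_symm, norm_neg]
    simpa using h2

/-- Global existence for an ODE whose vector field is continuous, globally Lipschitz in the space
variable with a constant independent of time, and vanishes at the origin. -/
lemma exists_global_solution_of_lipschitz {E : Type*} [NormedAddCommGroup E] [NormedSpace ℝ E]
    [CompleteSpace E] {f : ℝ → E → E} (hf : Continuous (Function.uncurry f)) {K : ℝ} (hK : 0 ≤ K)
    (hlip : ∀ t x y, ‖f t x - f t y‖ ≤ K * ‖x - y‖) (hzero : ∀ t, f t 0 = 0) (x₀ : E) :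
    ∃ y : ℝ → E, y 0 = x₀ ∧ ∀ t, HasDerivAt y (f t (y t)) t := by
  set L : ℝ := K + 1 with hLdef
  have hL : 0 < L := by positivity
  let G : BoundedContinuousFunction ℝ E → ℝ → E := fun y s => f s (Real.exp (L * |s|) • y s)
  have hGc : ∀ y, Continuous (G y) := fun y => by
    have : Continuous fun s : ℝ => (s, Real.exp (L * |s|) • y s) := by fun_prop
    exact hf.comp this
  let I : BoundedContinuousFunction ℝ E → ℝ → E := fun y t => x₀ + ∫ s in (0:ℝ)..t, G y s
  have hIc : ∀ y, Continuous (I y) := fun y =>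
    continuous_const.add (intervalIntegral.continuous_primitive
      (fun a b => (hGc y).intervalIntegrable a b) 0)
  have hGd : ∀ y z s, ‖G y s - G z s‖ ≤ K * dist y z * Real.exp (L * |s|) := by
    intro y z s
    refine (hlip _ _ _).trans ?_
    rw [← smul_sub, norm_smul, Real.norm_of_nonneg (Real.exp_pos _).le, mul_assoc]
    have := BoundedContinuousFunction.dist_coe_le_dist (f := y) (g := z) s
    rw [dist_eq_norm] at this
    have h2 := mul_le_mul_of_nonneg_left this (Real.exp_pos (L * |s|)).le
    rw [mul_comm (dist y z)]
    exact mul_le_mul_of_nonneg_left h2 hK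
  have hId : ∀ y z t, ‖I y t - I z t‖ ≤ K * dist y z / L * Real.exp (L * |t|) := by
    intro y z t
    have : I y t - I z t = ∫ s in (0:ℝ)..t, (G y s - G z s) := by
      rw [intervalIntegral.integral_sub ((hGc y).intervalIntegrable _ _)
        ((hGc z).intervalIntegrable _ _)]
      simp [I]
    rw [this]
    exact norm_integral_le_exp_abs (by positivity) hL (hGd y z) t
  have hI0 : ∀ t, I 0 t = x₀ := fun t => by simp [I, G, hzero]
  have hee : ∀ t, Real.exp (-(L * |t|)) * Real.exp (L * |t|) = 1 := fun t => by
    rw [← Real.exp_add]; simp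
  have he1 : ∀ t, Real.exp (-(L * |t|)) ≤ 1 := fun t =>
    Real.exp_le_one_iff.2 (by have := abs_nonneg t; nlinarith)
  have hTb : ∀ y t, ‖Real.exp (-(L * |t|)) • I y t‖ ≤ ‖x₀‖ + K * dist y 0 / L := by
    intro y t
    rw [norm_smul, Real.norm_of_nonneg (Real.exp_pos _).le]
    have h1 := hId y 0 t
    rw [hI0] at h1
    have h2 : ‖I y t‖ ≤ ‖x₀‖ + K * dist y 0 / L * Real.exp (L * |t|) := by
      have := norm_le_insert' (I y t) x₀
      linarith
    calc _ ≤ Real.exp (-(L * |t|)) * (‖x₀‖ + K * dist y 0 / L * Real.exp (L * |t|)) :=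
          mul_le_mul_of_nonneg_left h2 (Real.exp_pos _).le
      _ = Real.exp (-(L * |t|)) * ‖x₀‖ + K * dist y 0 / L *
          (Real.exp (-(L * |t|)) * Real.exp (L * |t|)) := by ring
      _ ≤ _ := by
        rw [hee]
        have := mul_le_mul_of_nonneg_right (he1 t) (norm_nonneg x₀)
        linarith
  let T : BoundedContinuousFunction ℝ E → BoundedContinuousFunction ℝ E := fun y =>
    BoundedContinuousFunction.ofNormedAddCommGroup (fun t => Real.exp (-(L * |t|)) • I y t)
      (by have := hIc y; fun_prop) _ (hTb y)
  have hT : ContractingWith (K / L).toNNReal T := by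
    constructor
    · rw [Real.toNNReal_lt_one, div_lt_one hL]
      linarith
    · refine LipschitzWith.of_dist_le_mul fun y z => ?_
      rw [Real.coe_toNNReal _ (by positivity)]
      rw [BoundedContinuousFunction.dist_le (by positivity)]
      intro t
      have : dist (T y t) (T z t) = Real.exp (-(L * |t|)) * ‖I y t - I z t‖ := by
        rw [dist_eq_norm]
        change ‖Real.exp (-(L * |t|)) • I y t - Real.exp (-(L * |t|)) • I z t‖ = _
        rw [← smul_sub, norm_smul, Real.norm_of_nonneg (Real.exp_pos _).le]
      rw [this]
      calc _ ≤ Real.exp (-(L * |t|)) * (K * dist y z / L * Real.exp (L * |t|)) :=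
            mul_le_mul_of_nonneg_left (hId y z t) (Real.exp_pos _).le
        _ = K * dist y z / L * (Real.exp (-(L * |t|)) * Real.exp (L * |t|)) := by ring
        _ = _ := by rw [hee]; ring
  obtain ⟨y, hy, -⟩ := hT.exists_fixedPoint 0 (edist_ne_top _ _)
  have hyI : ∀ t, Real.exp (L * |t|) • y t = I y t := by
    intro t
    have h1 : y t = Real.exp (-(L * |t|)) • I y t := by
      conv_lhs => rw [← hy]
      rfl
    rw [h1, smul_smul, mul_comm, hee, one_smul]
  refine ⟨I y, by simp [I], fun t => ?_⟩
  have h1 : HasDerivAt (I y) (G y t) t :=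
    (intervalIntegral.integral_hasDerivAt_right ((hGc y).intervalIntegrable _ _)
      ((hGc y).stronglyMeasurableAtFilter _ _) (hGc y).continuousAt).const_add x₀
  rw [← hyI t]
  exact h1

/-- Global solvability of `u'' + 2 d u' + c(t) l² u = 0` with bounded continuous `c`. -/
lemma exists_damped_solution {c : ℝ → ℝ} (hc : Continuous c) {M : ℝ}
    (hM : ∀ t, |c t| ≤ M) (d l a b : ℝ) :
    ∃ u p : ℝ → ℝ, u 0 = a ∧ p 0 = b ∧ (∀ t, HasDerivAt u (p t) t) ∧
      ∀ t, HasDerivAt p (-(2 * d * p t) - c t * l ^ 2 * u t) t := by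
  have hM0 : 0 ≤ M := (abs_nonneg _).trans (hM 0)
  let f : ℝ → ℝ × ℝ → ℝ × ℝ := fun t x => (x.2, -(2 * d * x.2) - c t * l ^ 2 * x.1)
  obtain ⟨y, hy0, hy⟩ := exists_global_solution_of_lipschitz (f := f)
    (K := 1 + 2 * |d| + M * l ^ 2)
    (by
      change Continuous fun q : ℝ × (ℝ × ℝ) => (q.2.2, -(2 * d * q.2.2) - c q.1 * l ^ 2 * q.2.1)
      fun_prop)
    (by positivity)
    (by
      intro t x z
      have h1 : |x.1 - z.1| ≤ ‖x - z‖ := norm_fst_le (x - z)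
      have h2 : |x.2 - z.2| ≤ ‖x - z‖ := norm_snd_le (x - z)
      have hn := norm_nonneg (x - z)
      have hd : 0 ≤ |d| * ‖x - z‖ := by positivity
      have hMl : 0 ≤ M * l ^ 2 * ‖x - z‖ := by positivity
      refine norm_prod_le_iff.2 ⟨?_, ?_⟩
      · change |x.2 - z.2| ≤ _
        nlinarith
      · change |(-(2 * d * x.2) - c t * l ^ 2 * x.1) - (-(2 * d * z.2) - c t * l ^ 2 * z.1)| ≤ _
        have e : (-(2 * d * x.2) - c t * l ^ 2 * x.1) - (-(2 * d * z.2) - c t * l ^ 2 * z.1)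
          = -(2 * (d * (x.2 - z.2))) - c t * l ^ 2 * (x.1 - z.1) := by ring
        rw [e]
        refine (abs_sub _ _).trans ?_
        rw [abs_neg, abs_mul, abs_mul, abs_mul, abs_mul, abs_two, abs_of_nonneg (sq_nonneg l)]
        have h3 : |d| * |x.2 - z.2| ≤ |d| * ‖x - z‖ :=
          mul_le_mul_of_nonneg_left h2 (abs_nonneg d)
        have h4 : |c t| * l ^ 2 * |x.1 - z.1| ≤ M * l ^ 2 * ‖x - z‖ :=
          mul_le_mul (mul_le_mul_of_nonneg_right (hM t) (sq_nonneg l)) h1 (abs_nonneg _)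
            (by positivity)
        nlinarith)
    (by intro t; simp [f]) (a, b)
  refine ⟨fun t => (y t).1, fun t => (y t).2, by simp [hy0], by simp [hy0], fun t => ?_,
    fun t => ?_⟩
  · exact (hasFDerivAt_fst.comp_hasDerivAt t (hy t))
  · exact (hasFDerivAt_snd.comp_hasDerivAt t (hy t))

lemma le_of_forall_hasDerivAt_nonpos {f f' : ℝ → ℝ} (hf : ∀ t, 0 ≤ t → HasDerivAt f (f' t) t)
    (hf' : ∀ t, 0 ≤ t → f' t ≤ 0) {t : ℝ} (ht : 0 ≤ t) : f t ≤ f 0 := by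
  have : AntitoneOn f (Ici 0) := by
    refine antitoneOn_of_deriv_nonpos (convex_Ici 0)
      (fun s hs => (hf s hs).continuousAt.continuousWithinAt)
      (fun s hs => (hf s (interior_subset hs)).differentiableAt.differentiableWithinAt)
      fun s hs => ?_
    rw [(hf s (interior_subset hs)).deriv]
    exact hf' s (interior_subset hs)
  exact this (mem_Ici.2 le_rfl) ht ht

/-- Energy estimate for `u'' + 2 d u' + c(t) l² u = 0` through the functional
`u'² + γ(t) l² u² + 2 θ (u u' + d u²)`, where `γ` is a regularization of `c`. -/
lemma energy_estimate {c γ γ' u p : ℝ → ℝ} {l d θ μ μ' D : ℝ} (hμ : 0 < μ) (hd : 0 ≤ d)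
    (hθ0 : 0 ≤ θ) (hθd : θ ≤ d) (hθl : 4 * θ ^ 2 ≤ μ * l ^ 2) (hθD : θ * d ≤ D * l ^ 2)
    (hu : ∀ t, 0 ≤ t → HasDerivAt u (p t) t)
    (hp : ∀ t, 0 ≤ t → HasDerivAt p (-(2 * d * p t) - c t * l ^ 2 * u t) t)
    (hγ : ∀ t, 0 ≤ t → HasDerivAt γ (γ' t) t)
    (hc : ∀ t, 0 ≤ t → μ ≤ c t) (hγ1 : ∀ t, 0 ≤ t → μ ≤ γ t) (hγ2 : γ 0 ≤ μ')
    (hγ' : ∀ t, 0 ≤ t → γ' t ≤ θ * μ)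
    (hγc : ∀ t, 0 ≤ t → (γ t - c t) ^ 2 * l ^ 2 ≤ 2 * d * θ * μ) {t : ℝ} (ht : 0 ≤ t) :
    p t ^ 2 + μ * (l ^ 2 * u t ^ 2) ≤
      3 * p 0 ^ 2 + (2 * μ' + μ + 4 * D) * (l ^ 2 * u 0 ^ 2) := by
  let F : ℝ → ℝ := fun t => p t ^ 2 + γ t * l ^ 2 * u t ^ 2 + 2 * θ * (u t * p t + d * u t ^ 2)
  let F' : ℝ → ℝ := fun t => (-4 * d + 2 * θ) * p t ^ 2 + (γ' t - 2 * θ * c t) * l ^ 2 * u t ^ 2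
    + 2 * (γ t - c t) * l ^ 2 * (u t * p t)
  have hF : ∀ t, 0 ≤ t → HasDerivAt F (F' t) t := by
    intro t ht
    have hu := hu t ht
    have hp := hp t ht
    have hγ := hγ t ht
    have := ((hp.pow 2).add (((hγ.mul_const (l ^ 2)).mul (hu.pow 2)))).add
      (((hu.mul hp).add ((hu.pow 2).const_mul d)).const_mul (2 * θ))
    refine this.congr_deriv ?_
    simp only [F', Pi.pow_apply]
    push_cast
    ring
  have hF' : ∀ t, 0 ≤ t → F' t ≤ 0 := by
    intro t ht
    have h1 := hc t ht
    have h2 := hγ' t ht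
    have h3 := hγc t ht
    have hX : (-4 * d + 2 * θ) * p t ^ 2 ≤ -2 * d * p t ^ 2 :=
      mul_le_mul_of_nonneg_right (by linarith) (sq_nonneg _)
    have hY : (γ' t - 2 * θ * c t) * (l ^ 2 * u t ^ 2) ≤ -(θ * μ) * (l ^ 2 * u t ^ 2) := by
      refine mul_le_mul_of_nonneg_right ?_ (by positivity)
      nlinarith
    have hZ : 2 * (γ t - c t) * l ^ 2 * (u t * p t) ≤
        2 * d * p t ^ 2 + θ * μ * (l ^ 2 * u t ^ 2) := by
      rcases hd.eq_or_lt with h0 | hdpos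
      · have : ((γ t - c t) * l) ^ 2 ≤ 0 := by
          rw [mul_pow]; simpa [← h0] using h3
        have h4 : (γ t - c t) * l = 0 := by
          exact pow_eq_zero_iff (two_ne_zero) |>.1 (le_antisymm this (sq_nonneg _))
        have h5 : 2 * (γ t - c t) * l ^ 2 * (u t * p t)
            = 2 * ((γ t - c t) * l) * l * (u t * p t) := by ring
        rw [h5, h4]
        have : 0 ≤ 2 * d * p t ^ 2 + θ * μ * (l ^ 2 * u t ^ 2) := by positivity
        linarith
      · have h4 : 0 ≤ (2 * d * p t - (γ t - c t) * l ^ 2 * u t) ^ 2 := sq_nonneg _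
        have h5 : (γ t - c t) ^ 2 * l ^ 2 * (l ^ 2 * u t ^ 2) ≤
            2 * d * θ * μ * (l ^ 2 * u t ^ 2) :=
          mul_le_mul_of_nonneg_right h3 (by positivity)
        have h6 : 0 ≤ 2 * d * (2 * d * p t ^ 2 + θ * μ * (l ^ 2 * u t ^ 2)
            - 2 * (γ t - c t) * l ^ 2 * (u t * p t)) := by
          nlinarith
        have := nonneg_of_mul_nonneg_right h6 (by positivity)
        linarith
    simp only [F']
    nlinarith
  have hmain := le_of_forall_hasDerivAt_nonpos hF hF' ht
  have hlow : p t ^ 2 + μ * (l ^ 2 * u t ^ 2) ≤ 2 * F t := by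
    have h1 : μ * (l ^ 2 * u t ^ 2) ≤ γ t * (l ^ 2 * u t ^ 2) :=
      mul_le_mul_of_nonneg_right (hγ1 t ht) (by positivity)
    have h2 : 0 ≤ (p t + 2 * θ * u t) ^ 2 := sq_nonneg _
    have h3 : 4 * θ ^ 2 * u t ^ 2 ≤ μ * l ^ 2 * u t ^ 2 :=
      mul_le_mul_of_nonneg_right hθl (sq_nonneg _)
    have h4 : 0 ≤ θ * d * u t ^ 2 := by positivity
    simp only [F]
    nlinarith
  have hup : 2 * F 0 ≤ 3 * p 0 ^ 2 + (2 * μ' + μ + 4 * D) * (l ^ 2 * u 0 ^ 2) := by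
    have h1 : γ 0 * (l ^ 2 * u 0 ^ 2) ≤ μ' * (l ^ 2 * u 0 ^ 2) :=
      mul_le_mul_of_nonneg_right hγ2 (by positivity)
    have h2 : 0 ≤ (p 0 - 2 * θ * u 0) ^ 2 := sq_nonneg _
    have h3 : 4 * θ ^ 2 * u 0 ^ 2 ≤ μ * l ^ 2 * u 0 ^ 2 :=
      mul_le_mul_of_nonneg_right hθl (sq_nonneg _)
    have h4 : θ * d * u 0 ^ 2 ≤ D * l ^ 2 * u 0 ^ 2 :=
      mul_le_mul_of_nonneg_right hθD (sq_nonneg _)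
    simp only [F]
    nlinarith
  linarith

/-- Continuous dependence of the solution of `u'' + 2 d u' + c(t) l² u = 0` on `c`. -/
lemma sq_sub_le_of_coeff_close {c c' u p u' p' : ℝ → ℝ} {l d M B ρ T : ℝ} (hd : 0 ≤ d)
    (hu : ∀ t, HasDerivAt u (p t) t)
    (hp : ∀ t, HasDerivAt p (-(2 * d * p t) - c t * l ^ 2 * u t) t)
    (hu' : ∀ t, HasDerivAt u' (p' t) t)
    (hp' : ∀ t, HasDerivAt p' (-(2 * d * p' t) - c' t * l ^ 2 * u' t) t)
    (h0 : u 0 = u' 0) (h1 : p 0 = p' 0)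
    (hM : ∀ t, |c' t| ≤ M) (hB : ∀ t, 0 ≤ t → l ^ 2 * u t ^ 2 ≤ B)
    (hT : 0 ≤ T) (hρ : ∀ t, 0 ≤ t → t ≤ T → |c t - c' t| ≤ ρ) :
    (u T - u' T) ^ 2 ≤ ρ ^ 2 * (l ^ 2 * B * T * Real.exp ((2 + M * l ^ 2) * T)) := by
  have hM0 : 0 ≤ M := (abs_nonneg _).trans (hM 0)
  set N := 2 + M * l ^ 2 with hN
  have hN0 : 0 ≤ N := by positivity
  let e := ρ ^ 2 * (l ^ 2 * B)
  let G : ℝ → ℝ := fun t => (u t - u' t) ^ 2 + (p t - p' t) ^ 2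
  let G' : ℝ → ℝ := fun t => 2 * (u t - u' t) * (p t - p' t) + 2 * (p t - p' t) *
    (-(2 * d * (p t - p' t)) - c' t * l ^ 2 * (u t - u' t) - (c t - c' t) * l ^ 2 * u t)
  have hG : ∀ t, HasDerivAt G (G' t) t := by
    intro t
    refine ((((hu t).sub (hu' t)).pow 2).add (((hp t).sub (hp' t)).pow 2)).congr_deriv ?_
    simp only [G', Pi.sub_apply]
    push_cast
    ring
  have hGle : ∀ t, 0 ≤ t → t ≤ T → G' t ≤ N * G t + e := by
    intro t ht htT
    set z := u t - u' t
    set q := p t - p' t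
    have a1 : 0 ≤ d * q ^ 2 := by positivity
    have a2 : -(c' t * l ^ 2 * (2 * z * q)) ≤ M * l ^ 2 * (z ^ 2 + q ^ 2) := by
      have b1 : |2 * z * q| ≤ z ^ 2 + q ^ 2 := by
        rw [abs_le]; constructor <;> nlinarith [sq_nonneg (z - q), sq_nonneg (z + q)]
      have b2 : |c' t * l ^ 2 * (2 * z * q)| ≤ M * l ^ 2 * (z ^ 2 + q ^ 2) := by
        rw [abs_mul, abs_mul, abs_of_nonneg (sq_nonneg l)]
        exact mul_le_mul (mul_le_mul_of_nonneg_right (hM t) (sq_nonneg l)) b1 (abs_nonneg _)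
          (by positivity)
      exact (neg_le_abs _).trans b2
    have a3 : ((c t - c' t) * l ^ 2 * u t) ^ 2 ≤ e := by
      have b1 : (c t - c' t) ^ 2 ≤ ρ ^ 2 := sq_le_sq' (by
        have := (abs_le.1 (hρ t ht htT)).1; linarith) (abs_le.1 (hρ t ht htT)).2
      have b2 : l ^ 2 * (l ^ 2 * u t ^ 2) ≤ l ^ 2 * B :=
        mul_le_mul_of_nonneg_left (hB t ht) (sq_nonneg l)
      calc _ = (c t - c' t) ^ 2 * (l ^ 2 * (l ^ 2 * u t ^ 2)) := by ring
        _ ≤ ρ ^ 2 * (l ^ 2 * B) := mul_le_mul b1 b2 (by positivity) (sq_nonneg _)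
    have a4 : -(2 * q * ((c t - c' t) * l ^ 2 * u t)) ≤
        q ^ 2 + ((c t - c' t) * l ^ 2 * u t) ^ 2 := by
      nlinarith [sq_nonneg (q + (c t - c' t) * l ^ 2 * u t)]
    have a5 : 2 * z * q ≤ z ^ 2 + q ^ 2 := by nlinarith [sq_nonneg (z - q)]
    have e1 : G' t = 2 * z * q - 4 * (d * q ^ 2) - c' t * l ^ 2 * (2 * z * q)
        - 2 * q * ((c t - c' t) * l ^ 2 * u t) := by
      simp only [G']; ring
    have e2 : N * G t = 2 * (z ^ 2 + q ^ 2) + M * l ^ 2 * (z ^ 2 + q ^ 2) := by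
      simp only [G, hN]; ring
    rw [e1, e2]
    nlinarith [sq_nonneg z]
  have he0 : 0 ≤ e := by
    have : 0 ≤ B := le_trans (by positivity) (hB 0 le_rfl)
    positivity
  let H : ℝ → ℝ := fun t => Real.exp (-(N * t)) * G t - e * t
  have hH : ∀ t, HasDerivAt H (Real.exp (-(N * t)) * (G' t - N * G t) - e) t := by
    intro t
    have h1 : HasDerivAt (fun t : ℝ => -(N * t)) (-N) t := by
      simpa using (hasDerivAt_id t).const_mul (-N)
    have h2 : HasDerivAt (fun t : ℝ => e * t) e t := by
      simpa using (hasDerivAt_id t).const_mul e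
    refine ((h1.exp.mul (hG t)).sub h2).congr_deriv ?_
    ring
  have hanti : AntitoneOn H (Icc 0 T) := by
    refine antitoneOn_of_deriv_nonpos (convex_Icc 0 T)
      (fun s _ => (hH s).continuousAt.continuousWithinAt)
      (fun s _ => (hH s).differentiableAt.differentiableWithinAt) fun s hs => ?_
    have hs' := interior_subset hs
    rw [(hH s).deriv]
    have b1 : Real.exp (-(N * s)) ≤ 1 :=
      Real.exp_le_one_iff.2 (by have := mul_nonneg hN0 hs'.1; linarith)
    have b2 := hGle s hs'.1 hs'.2
    have b3 := (Real.exp_pos (-(N * s))).le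
    have b4 : Real.exp (-(N * s)) * (G' s - N * G s) ≤ Real.exp (-(N * s)) * e :=
      mul_le_mul_of_nonneg_left (by linarith) b3
    have b5 : Real.exp (-(N * s)) * e ≤ 1 * e := mul_le_mul_of_nonneg_right b1 he0
    linarith
  have hend := hanti (left_mem_Icc.2 hT) (right_mem_Icc.2 hT) hT
  have hH0 : H 0 = 0 := by simp [H, G, h0, h1]
  rw [hH0] at hend
  have hGT : Real.exp (-(N * T)) * G T ≤ e * T := by simp only [H] at hend; linarith
  have hee : Real.exp (N * T) * Real.exp (-(N * T)) = 1 := by rw [← Real.exp_add]; simp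
  have hfin : G T ≤ Real.exp (N * T) * (e * T) := by
    have := mul_le_mul_of_nonneg_left hGT (Real.exp_pos (N * T)).le
    rwa [← mul_assoc, hee, one_mul] at this
  calc (u T - u' T) ^ 2 ≤ G T := by simp only [G]; nlinarith [sq_nonneg (p T - p' T)]
    _ ≤ Real.exp (N * T) * (e * T) := hfin
    _ = _ := by simp only [e]; ring

/-- The forward average `l ∫_t^{t+1/l} c` of a continuous function. -/
lemma hasDerivAt_forward_average {c : ℝ → ℝ} (hc : Continuous c) (l t : ℝ) :
    HasDerivAt (fun t => l * ∫ s in t..(t + l⁻¹), c s) (l * (c (t + l⁻¹) - c t)) t := by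
  have hP : ∀ t, HasDerivAt (fun t => ∫ s in (0:ℝ)..t, c s) (c t) t := fun t =>
    intervalIntegral.integral_hasDerivAt_right (hc.intervalIntegrable _ _)
      (hc.stronglyMeasurableAtFilter _ _) hc.continuousAt
  have h1 : HasDerivAt (fun t => ∫ s in (0:ℝ)..(t + l⁻¹), c s) (c (t + l⁻¹)) t :=
    (hP (t + l⁻¹)).comp_add_const t l⁻¹
  refine ((h1.sub (hP t)).const_mul l).congr_of_eventuallyEq (Eventually.of_forall fun s => ?_)
  have := intervalIntegral.integral_interval_sub_left (μ := volume)
    (hc.intervalIntegrable 0 (s + l⁻¹)) (hc.intervalIntegrable 0 s)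
  simp only [Pi.sub_apply, this]

lemma forward_average_sub_le {c : ℝ → ℝ} (hc : Continuous c) {l t a b : ℝ} (hl : 0 < l)
    (h : ∀ s, t ≤ s → s ≤ t + l⁻¹ → |c s - a| ≤ b) :
    |(l * ∫ s in t..(t + l⁻¹), c s) - a| ≤ b := by
  have h1 : (l * ∫ s in t..(t + l⁻¹), c s) - a = l * ∫ s in t..(t + l⁻¹), (c s - a) := by
    rw [intervalIntegral.integral_sub (hc.intervalIntegrable _ _)
      (continuous_const.intervalIntegrable _ _), intervalIntegral.integral_const]
    simp only [add_sub_cancel_left, smul_eq_mul]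
    field_simp
  have hi : 0 < l⁻¹ := inv_pos.2 hl
  have h2 : ‖∫ s in t..(t + l⁻¹), (c s - a)‖ ≤ b * |t + l⁻¹ - t| := by
    refine intervalIntegral.norm_integral_le_of_norm_le_const fun s hs => ?_
    rw [uIoc_of_le (by linarith)] at hs
    exact h s hs.1.le hs.2
  rw [add_sub_cancel_left, abs_of_pos hi, Real.norm_eq_abs] at h2
  rw [h1, abs_mul, abs_of_pos hl]
  calc _ ≤ l * (b * l⁻¹) := mul_le_mul_of_nonneg_left h2 hl.le
    _ = b := by field_simp

/-- If the coefficient `c` is close to a constant and has a small Hölder constant of exponent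
`1 - 2σ`, the solutions of `u'' + 2 δ l^{2σ} u' + c(t) l² u = 0` have energy bounded in terms of
their initial energy, uniformly in time and in the frequency `l`. -/
lemma exists_uniform_energy_bound {μ μ' σ δ : ℝ} (hμ : 0 < μ) (hσ0 : 0 < σ)
    (hσ : σ ≤ 1 / 2) (hδ : 0 < δ) :
    ∃ κ > 0, κ ≤ 1 ∧ ∃ K > 0, ∀ (c : ℝ → ℝ) (c₀ : ℝ), Continuous c → (∀ t, μ ≤ c t) →
      μ ≤ c₀ → c₀ ≤ μ' → (∀ t, |c t - c₀| ≤ κ) →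
      (∀ t τ, |c t - c τ| ≤ κ * |t - τ| ^ (1 - 2 * σ)) →
      ∀ (l : ℝ) (u p : ℝ → ℝ), 0 ≤ l → (∀ t, HasDerivAt u (p t) t) →
        (∀ t, HasDerivAt p (-(2 * (δ * l ^ (2 * σ)) * p t) - c t * l ^ 2 * u t) t) →
        ∀ t, 0 ≤ t → p t ^ 2 + l ^ 2 * u t ^ 2 ≤ K * (p 0 ^ 2 + l ^ 2 * u 0 ^ 2) := by
  set a := min δ (min 1 (μ / 4)) with ha
  have ha0 : 0 < a := by positivity
  have haδ : a ≤ δ := min_le_left _ _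
  have ha1 : a ≤ 1 := (min_le_right _ _).trans (min_le_left _ _)
  have haμ : a ≤ μ / 4 := (min_le_right _ _).trans (min_le_right _ _)
  have ha2 : 4 * a ^ 2 ≤ μ := by nlinarith
  set κ := min 1 (min (a * μ) (2 * δ * a * μ)) with hκ
  have hκ0 : 0 < κ := by positivity
  have hκ1 : κ ≤ 1 := min_le_left _ _
  have hκa : κ ≤ a * μ := (min_le_right _ _).trans (min_le_left _ _)
  have hκ2 : κ ^ 2 ≤ 2 * δ * a * μ := by
    have h1 : κ ≤ 2 * δ * a * μ := (min_le_right _ _).trans (min_le_right _ _)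
    nlinarith
  set D := δ * a with hD
  set Q := max 3 (2 * (μ' + 1) + μ + 4 * D) with hQ
  have hQ0 : 0 < Q := lt_of_lt_of_le (by norm_num) (le_max_left _ _)
  have hm0 : 0 < min 1 μ := by positivity
  refine ⟨κ, hκ0, hκ1, Q / min 1 μ, by positivity, ?_⟩
  intro c c₀ hc hcμ hc₀ hc₀' hcc₀ hch l u p hl hu hp t ht
  -- abstract form of the two frequency regimes
  have main : ∀ (y z : ℝ) (γ γ' : ℝ → ℝ), y = l ^ (2 * σ) → 0 ≤ z → z ≤ l → z ≤ y →
      z * y ≤ l ^ 2 → (∀ t, HasDerivAt γ (γ' t) t) → (∀ t, μ ≤ γ t) → γ 0 ≤ μ' + 1 →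
      (∀ t, γ' t ≤ κ * z) → (∀ t, (γ t - c t) ^ 2 * l ^ 2 ≤ κ ^ 2 * (z * y)) →
      p t ^ 2 + l ^ 2 * u t ^ 2 ≤ Q / min 1 μ * (p 0 ^ 2 + l ^ 2 * u 0 ^ 2) := by
    intro y z γ γ' hy hz hzl hzy hzy2 hγ hγμ hγ0 hγ' hγc
    have hy0 : 0 ≤ y := hz.trans hzy
    have hen := energy_estimate (c := c) (γ := γ) (γ' := γ') (u := u) (p := p) (l := l)
      (d := δ * y) (θ := a * z) (μ := μ) (μ' := μ' + 1) (D := D) hμ (by positivity) (by positivity)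
      (mul_le_mul haδ hzy hz hδ.le)
      (by
        have : z ^ 2 ≤ l ^ 2 := pow_le_pow_left₀ hz hzl 2
        calc 4 * (a * z) ^ 2 = 4 * a ^ 2 * z ^ 2 := by ring
          _ ≤ μ * l ^ 2 := mul_le_mul ha2 this (by positivity) hμ.le)
      (by
        calc a * z * (δ * y) = D * (z * y) := by simp only [hD]; ring
          _ ≤ D * l ^ 2 := mul_le_mul_of_nonneg_left hzy2 (by positivity))
      (fun t _ => hu t) (fun t _ => by rw [hy]; exact hp t) (fun t _ => hγ t)
      (fun t _ => hcμ t) (fun t _ => hγμ t) hγ0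
      (fun t _ => (hγ' t).trans (by
        have := mul_le_mul_of_nonneg_right hκa hz
        linarith))
      (fun t _ => (hγc t).trans (by
        have := mul_le_mul_of_nonneg_right hκ2 (mul_nonneg hz hy0)
        linarith)) ht
    have hX : 0 ≤ l ^ 2 * u t ^ 2 := by positivity
    have hX0 : 0 ≤ l ^ 2 * u 0 ^ 2 := by positivity
    have h1 : min 1 μ * (p t ^ 2 + l ^ 2 * u t ^ 2) ≤ p t ^ 2 + μ * (l ^ 2 * u t ^ 2) := by
      have b1 := mul_le_mul_of_nonneg_right (min_le_left 1 μ) (sq_nonneg (p t))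
      have b2 := mul_le_mul_of_nonneg_right (min_le_right 1 μ) hX
      linarith
    have h2 : 3 * p 0 ^ 2 + (2 * (μ' + 1) + μ + 4 * D) * (l ^ 2 * u 0 ^ 2) ≤
        Q * (p 0 ^ 2 + l ^ 2 * u 0 ^ 2) := by
      have b1 := mul_le_mul_of_nonneg_right
        (le_max_left 3 (2 * (μ' + 1) + μ + 4 * D)) (sq_nonneg (p 0))
      have b2 := mul_le_mul_of_nonneg_right
        (le_max_right 3 (2 * (μ' + 1) + μ + 4 * D)) hX0
      linarith
    rw [div_mul_eq_mul_div, le_div_iff₀ hm0, mul_comm]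
    linarith
  rcases le_or_gt l 1 with hl1 | hl1
  · rcases hl.eq_or_lt with h0 | hlpos
    · subst h0
      refine main 0 0 (fun _ => c₀) (fun _ => 0) ?_ le_rfl le_rfl le_rfl (by simp)
        (fun t => hasDerivAt_const t c₀) (fun _ => hc₀) (by linarith) (by simp) (by simp)
      rw [Real.zero_rpow (by positivity)]
    · have hzy : l ^ (2 - 2 * σ) * l ^ (2 * σ) = l ^ 2 := by
        rw [← Real.rpow_add hlpos, sub_add_cancel]; norm_num
      refine main (l ^ (2 * σ)) (l ^ (2 - 2 * σ)) (fun _ => c₀) (fun _ => 0) rfl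
        (by positivity) ?_ ?_ hzy.le
        (fun t => hasDerivAt_const t c₀) (fun _ => hc₀) (by linarith)
        (fun t => by positivity) fun t => ?_
      · calc l ^ (2 - 2 * σ) ≤ l ^ (1:ℝ) :=
              Real.rpow_le_rpow_of_exponent_ge hlpos hl1 (by linarith)
          _ = l := Real.rpow_one l
      · exact Real.rpow_le_rpow_of_exponent_ge hlpos hl1 (by linarith)
      · rw [hzy]
        refine mul_le_mul_of_nonneg_right ?_ (sq_nonneg l)
        have := hcc₀ t
        rw [abs_sub_comm] at this
        exact sq_le_sq' (by linarith [(abs_le.1 this).1]) (abs_le.1 this).2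
  · have hlpos : 0 < l := by linarith
    have hi : 0 < l⁻¹ := inv_pos.2 hlpos
    have hpow : l⁻¹ ^ (1 - 2 * σ) * l = l ^ (2 * σ) := by
      rw [Real.inv_rpow hl, ← Real.rpow_neg hl]
      nth_rewrite 2 [← Real.rpow_one l]
      rw [← Real.rpow_add hlpos]
      congr 1; ring
    have hyl : l ^ (2 * σ) ≤ l := by
      calc l ^ (2 * σ) ≤ l ^ (1:ℝ) := Real.rpow_le_rpow_of_exponent_le hl1.le (by linarith)
        _ = l := Real.rpow_one l
    have hy0 : 0 ≤ l ^ (2 * σ) := by positivity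
    refine main (l ^ (2 * σ)) (l ^ (2 * σ)) _ _ rfl hy0 hyl le_rfl
      (by rw [sq]; exact mul_le_mul hyl hyl hy0 hl) (hasDerivAt_forward_average hc l) ?_ ?_ ?_ ?_
    · intro t
      have h1 : ∫ s in t..(t + l⁻¹), (μ:ℝ) ≤ ∫ s in t..(t + l⁻¹), c s :=
        intervalIntegral.integral_mono_on (by linarith) (continuous_const.intervalIntegrable _ _)
          (hc.intervalIntegrable _ _) fun s _ => hcμ s
      rw [intervalIntegral.integral_const, add_sub_cancel_left, smul_eq_mul] at h1
      have h2 := mul_le_mul_of_nonneg_left h1 hl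
      rwa [← mul_assoc, mul_inv_cancel₀ hlpos.ne', one_mul] at h2
    · have := forward_average_sub_le hc hlpos (t := 0) (a := c₀) (b := κ) fun s _ _ => hcc₀ s
      have := (abs_le.1 this).2
      linarith
    · intro t
      have h1 := hch (t + l⁻¹) t
      rw [add_sub_cancel_left, abs_of_pos hi] at h1
      calc l * (c (t + l⁻¹) - c t) ≤ l * (κ * l⁻¹ ^ (1 - 2 * σ)) :=
            mul_le_mul_of_nonneg_left ((le_abs_self _).trans h1) hl
        _ = κ * (l⁻¹ ^ (1 - 2 * σ) * l) := by ring
        _ = κ * l ^ (2 * σ) := by rw [hpow]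
    · intro t
      have h1 := forward_average_sub_le hc hlpos (t := t) (a := c t)
        (b := κ * l⁻¹ ^ (1 - 2 * σ)) fun s hs hs' => (hch s t).trans (by
          refine mul_le_mul_of_nonneg_left ?_ hκ0.le
          refine Real.rpow_le_rpow (abs_nonneg _) ?_ (by linarith)
          rw [abs_of_nonneg (by linarith)]
          linarith)
      have h2 := mul_le_mul_of_nonneg_right h1 hl
      rw [mul_assoc, hpow] at h2
      calc _ = (|(l * ∫ s in t..(t + l⁻¹), c s) - c t| * l) ^ 2 := by rw [mul_pow, sq_abs]
        _ ≤ (κ * l ^ (2 * σ)) ^ 2 := pow_le_pow_left₀ (by positivity) h2 2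
        _ = _ := by ring

/-- Functions with values in `[0, η]` whose modulus of continuity is at most `Ω`. -/
def boundedModulusSet (η : ℝ) (Ω : ℝ → ℝ) : Set (ℝ → ℝ) :=
  {s | (∀ t, s t ∈ Icc 0 η) ∧ ∀ t τ, |s t - s τ| ≤ Ω (t - τ)}

lemma boundedModulusSet.continuous {η : ℝ} {Ω s : ℝ → ℝ} (hs : s ∈ boundedModulusSet η Ω)
    (hΩ : Tendsto Ω (𝓝 0) (𝓝 0)) : Continuous s := by
  refine continuous_iff_continuousAt.2 fun t => ?_
  rw [ContinuousAt, tendsto_iff_norm_sub_tendsto_zero]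
  have h1 : Tendsto (fun τ => τ - t) (𝓝 t) (𝓝 0) := by
    have : Continuous fun τ : ℝ => τ - t := by fun_prop
    simpa using this.tendsto t
  exact squeeze_zero (fun _ => norm_nonneg _) (fun τ => hs.2 τ t) (hΩ.comp h1)

lemma boundedModulusSet.tendstoUniformlyOn {η : ℝ} {Ω : ℝ → ℝ} (hΩ : Tendsto Ω (𝓝 0) (𝓝 0))
    {l : Filter ℕ} {w : ℕ → ℝ → ℝ} {s : ℝ → ℝ} (hw : ∀ n, w n ∈ boundedModulusSet η Ω)
    (hs : s ∈ boundedModulusSet η Ω) (h : ∀ t, Tendsto (fun n => w n t) l (𝓝 (s t))) (T : ℝ) :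
    TendstoUniformlyOn w s l (Icc 0 T) := by
  rw [Metric.tendstoUniformlyOn_iff]
  intro ε hε
  obtain ⟨ρ, hρ, hΩρ⟩ := Metric.tendsto_nhds_nhds.1 hΩ (ε / 3) (by positivity)
  obtain ⟨N, -, hNfin, hN⟩ := (isCompact_Icc (a := (0:ℝ)) (b := T)).finite_cover_balls hρ
  have hev : ∀ᶠ n in l, ∀ x ∈ N, dist (w n x) (s x) < ε / 3 :=
    (eventually_all_finite hNfin).2 fun x _ =>
      Metric.tendsto_nhds.1 (h x) (ε / 3) (by positivity)
  filter_upwards [hev] with n hn t ht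
  obtain ⟨x, hx, hxt⟩ := mem_iUnion₂.1 (hN ht)
  have h1 : Ω (t - x) < ε / 3 := by
    have := hΩρ (x := t - x) (by simpa [Real.dist_eq] using hxt)
    rw [Real.dist_eq, sub_zero] at this
    exact (le_abs_self _).trans_lt this
  have h2 := (hw n).2 t x
  have h3 := hs.2 t x
  have h4 := hn x hx
  rw [Real.dist_eq] at h4 ⊢
  rw [abs_lt] at h4 ⊢
  rw [abs_le] at h2 h3
  constructor <;> linarith [h2.1, h2.2, h3.1, h3.2, h4.1, h4.2]

/-- A causal, continuous self-map of an equicontinuous bounded family of functions of time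
has a fixed point, obtained as a limit of solutions of delayed equations. -/
lemma exists_fixedPoint_of_causal {η : ℝ} {Ω : ℝ → ℝ} (hΩ : Tendsto Ω (𝓝 0) (𝓝 0)) {a : ℝ}
    (ha : (fun _ => a) ∈ boundedModulusSet η Ω) {Φ : (ℝ → ℝ) → ℝ → ℝ}
    (hmaps : ∀ s ∈ boundedModulusSet η Ω, Φ s ∈ boundedModulusSet η Ω)
    (hneg : ∀ s ∈ boundedModulusSet η Ω, ∀ t ≤ 0, Φ s t = a)
    (hcausal : ∀ s ∈ boundedModulusSet η Ω, ∀ s' ∈ boundedModulusSet η Ω, ∀ T,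
      (∀ t ≤ T, s t = s' t) → ∀ t ≤ T, Φ s t = Φ s' t)
    (hcont : ∀ (l : Filter ℕ) (w : ℕ → ℝ → ℝ), (∀ n, w n ∈ boundedModulusSet η Ω) →
      ∀ s ∈ boundedModulusSet η Ω, (∀ T, TendstoUniformlyOn w s l (Icc 0 T)) →
      ∀ t, Tendsto (fun n => Φ (w n) t) l (𝓝 (Φ s t))) :
    ∃ s ∈ boundedModulusSet η Ω, ∀ t, Φ s t = s t := by
  let D : ℝ → (ℝ → ℝ) → ℝ → ℝ := fun h s t => s (t - h)
  have hD : ∀ h, ∀ s ∈ boundedModulusSet η Ω, D h s ∈ boundedModulusSet η Ω := by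
    intro h s hs
    refine ⟨fun t => hs.1 _, fun t τ => ?_⟩
    have := hs.2 (t - h) (τ - h)
    rwa [sub_sub_sub_cancel_right] at this
  let X : ℝ → ℕ → ℝ → ℝ := fun h j => (fun s => Φ (D h s))^[j] (fun _ => a)
  have hXs : ∀ h j, X h (j + 1) = Φ (D h (X h j)) := fun h j =>
    Function.iterate_succ_apply' _ _ _
  have hXm : ∀ h j, X h j ∈ boundedModulusSet η Ω := by
    intro h j
    induction j with
    | zero => exact ha
    | succ j ih => rw [hXs]; exact hmaps _ (hD _ _ ih)
  have hXst : ∀ (h : ℝ) (j : ℕ), ∀ t ≤ (j : ℝ) * h, X h (j + 1) t = X h j t := by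
    intro h j
    induction j with
    | zero =>
      intro t ht
      rw [hXs, hneg _ (hD _ _ (hXm _ _)) t (by simpa using ht)]
      rfl
    | succ j ih =>
      intro t ht
      refine ((congrFun (hXs h (j + 1)) t).trans ?_).trans (congrFun (hXs h j) t).symm
      refine hcausal _ (hD _ _ (hXm _ _)) _ (hD _ _ (hXm _ _)) ((j + 1 : ℕ) * h) ?_ t ht
      intro r hr
      refine ih _ ?_
      push_cast at hr
      linarith
  let h : ℕ → ℝ := fun n => 1 / ((n : ℝ) + 1)
  let v : ℕ → ℝ → ℝ := fun n => X (h n) ((n + 1) ^ 2)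
  have hv : ∀ n, v n ∈ boundedModulusSet η Ω := fun n => hXm _ _
  have hvfix : ∀ n : ℕ, ∀ t ≤ (n : ℝ) + 1, Φ (D (h n) (v n)) t = v n t := by
    intro n t ht
    rw [← hXs]
    refine hXst _ _ t ?_
    have : (((n + 1) ^ 2 : ℕ) : ℝ) * h n = n + 1 := by
      simp only [h]
      push_cast
      field_simp
    rwa [this]
  let U : Ultrafilter ℕ := hyperfilter ℕ
  have hlim : ∀ t, ∃ x, Tendsto (fun n => v n t) U (𝓝 x) := by
    intro t
    obtain ⟨x, -, hx⟩ := (isCompact_Icc (a := (0:ℝ)) (b := η)).ultrafilter_le_nhds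
      (U.map fun n => v n t) (by
        rw [le_principal_iff]
        exact Ultrafilter.mem_map.2 (univ_mem' fun n => (hv n).1 t))
    exact ⟨x, hx⟩
  choose s hs using hlim
  have hsm : s ∈ boundedModulusSet η Ω := by
    refine ⟨fun t => isClosed_Icc.mem_of_tendsto (hs t) (Eventually.of_forall fun n => (hv n).1 t),
      fun t τ => ?_⟩
    exact le_of_tendsto ((hs t).sub (hs τ)).abs (Eventually.of_forall fun n => (hv n).2 t τ)
  have hU : (U : Filter ℕ) ≤ atTop := Nat.hyperfilter_le_atTop
  have hh : Tendsto h U (𝓝 0) := tendsto_one_div_add_atTop_nhds_zero_nat.mono_left hU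
  have hDs : ∀ t, Tendsto (fun n => D (h n) (v n) t) U (𝓝 (s t)) := by
    intro t
    have h1 : Tendsto (fun n => D (h n) (v n) t - v n t) U (𝓝 0) := by
      have h2 : Tendsto (fun n => Ω (-h n)) U (𝓝 0) := by
        refine hΩ.comp ?_
        simpa using hh.neg
      refine squeeze_zero_norm (fun n => ?_) h2
      have := (hv n).2 (t - h n) t
      rwa [sub_sub_cancel_left] at this
    simpa using h1.add (hs t)
  refine ⟨s, hsm, fun t => ?_⟩
  have h1 := hcont U (fun n => D (h n) (v n)) (fun n => hD _ _ (hv n)) s hsm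
    (boundedModulusSet.tendstoUniformlyOn hΩ (fun n => hD _ _ (hv n)) hsm hDs) t
  refine tendsto_nhds_unique (h1.congr' ?_) (hs t)
  obtain ⟨N, hN⟩ := exists_nat_ge t
  filter_upwards [hU (eventually_ge_atTop N)] with n hn
  have : (N : ℝ) ≤ n := by exact_mod_cast hn
  exact hvfix n t (by linarith)

lemma abs_mul_sq_sub_le {u p : ℝ → ℝ} {l b : ℝ} (hl : 0 ≤ l)
    (hu : ∀ t, HasDerivAt u (p t) t) (hb : ∀ t, 0 ≤ t → p t ^ 2 + l ^ 2 * u t ^ 2 ≤ b)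
    {t τ : ℝ} (ht : 0 ≤ t) (hτ : 0 ≤ τ) :
    |l ^ 2 * u t ^ 2 - l ^ 2 * u τ ^ 2| ≤ b * min 1 (l * |t - τ|) := by
  have hb0 : 0 ≤ b := le_trans (by positivity) (hb 0 le_rfl)
  have hle : ∀ t, 0 ≤ t → l ^ 2 * u t ^ 2 ≤ b := fun t ht => by
    nlinarith [hb t ht, sq_nonneg (p t)]
  rw [mul_min_of_nonneg _ _ hb0, mul_one]
  refine le_min ?_ ?_
  · have h1 : 0 ≤ l ^ 2 * u t ^ 2 := by positivity
    have h2 : 0 ≤ l ^ 2 * u τ ^ 2 := by positivity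
    rw [abs_le]
    constructor <;> linarith [hle t ht, hle τ hτ]
  · have hd : ∀ r ∈ Ici (0:ℝ), HasDerivWithinAt (fun r => l ^ 2 * u r ^ 2)
        (l ^ 2 * (2 * u r * p r)) (Ici 0) r := by
      intro r _
      refine HasDerivAt.hasDerivWithinAt ?_
      refine (((hu r).pow 2).const_mul (l ^ 2)).congr_deriv ?_
      push_cast
      ring
    have hbd : ∀ r ∈ Ici (0:ℝ), ‖l ^ 2 * (2 * u r * p r)‖ ≤ b * l := by
      intro r hr
      have h1 : l ^ 2 * (2 * u r * p r) = (2 * (l * u r) * p r) * l := by ring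
      rw [Real.norm_eq_abs, h1, abs_mul, abs_of_nonneg hl]
      refine mul_le_mul_of_nonneg_right ?_ hl
      have h2 := hb r hr
      rw [abs_le]
      constructor <;> nlinarith [sq_nonneg (l * u r + p r), sq_nonneg (l * u r - p r)]
    have := (convex_Ici (0:ℝ)).norm_image_sub_le_of_norm_hasDerivWithin_le hd hbd hτ ht
    rw [Real.norm_eq_abs, Real.norm_eq_abs, mul_assoc] at this
    exact this

lemma tendsto_tsum_mul_min {b l : ℕ → ℝ} (hb : Summable b) (hb0 : ∀ k, 0 ≤ b k)
    (hl : ∀ k, 0 ≤ l k) :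
    Tendsto (fun h : ℝ => ∑' k, b k * min 1 (l k * |h|)) (𝓝 0) (𝓝 0) := by
  have h0 : (∑' k, b k * min 1 (l k * |(0:ℝ)|)) = 0 := by simp
  nth_rewrite 2 [← h0]
  refine tendsto_tsum_of_dominated_convergence hb (fun k => ?_)
    (Eventually.of_forall fun h k => ?_)
  · have : Continuous fun h : ℝ => b k * min 1 (l k * |h|) := by fun_prop
    exact this.tendsto 0
  · have h1 : 0 ≤ min 1 (l k * |h|) := le_min zero_le_one (mul_nonneg (hl k) (abs_nonneg h))
    rw [Real.norm_of_nonneg (mul_nonneg (hb0 k) h1)]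
    exact mul_le_of_le_one_right (hb0 k) (min_le_left _ _)

/-- Existence of a family of components solving the Kirchhoff system, provided all the linearized
problems satisfy a uniform summable energy bound. -/
lemma exists_kirchhoff_components {m : ℝ → ℝ} {M η : ℝ} {l d b u0 u1 : ℕ → ℝ}
    (hl : ∀ k, 0 ≤ l k) (hd : ∀ k, 0 ≤ d k) (hb : Summable b) (hbη : ∑' k, b k ≤ η)
    (hm : UniformContinuousOn m (Ici 0)) (hmM : ∀ x ∈ Icc 0 η, |m x| ≤ M)
    (hb1 : ∀ k, u1 k ^ 2 + l k ^ 2 * u0 k ^ 2 ≤ b k)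
    (hen : ∀ s ∈ boundedModulusSet η (fun h => ∑' k, b k * min 1 (l k * |h|)),
      Continuous (fun t => m (s t)) → ∀ k u p, u 0 = u0 k → p 0 = u1 k →
      (∀ t, HasDerivAt u (p t) t) →
      (∀ t, HasDerivAt p (-(2 * d k * p t) - m (s t) * l k ^ 2 * u t) t) →
      ∀ t, 0 ≤ t → p t ^ 2 + l k ^ 2 * u t ^ 2 ≤ b k) :
    ∃ (s : ℝ → ℝ) (u p : ℕ → ℝ → ℝ), Continuous (fun t => m (s t)) ∧
      (∀ t, 0 ≤ t → s t = ∑' k, l k ^ 2 * u k t ^ 2) ∧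
      ∀ k, u k 0 = u0 k ∧ p k 0 = u1 k ∧ (∀ t, HasDerivAt (u k) (p k t) t) ∧
      (∀ t, HasDerivAt (p k) (-(2 * d k * p k t) - m (s t) * l k ^ 2 * u k t) t) ∧
      ∀ t, 0 ≤ t → p k t ^ 2 + l k ^ 2 * u k t ^ 2 ≤ b k := by
  have hb0 : ∀ k, 0 ≤ b k := fun k => le_trans (by positivity) (hb1 k)
  set Ω : ℝ → ℝ := fun h => ∑' k, b k * min 1 (l k * |h|) with hΩdef
  have hΩ : Tendsto Ω (𝓝 0) (𝓝 0) := tendsto_tsum_mul_min hb hb0 hl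
  have hmin0 : ∀ k h, 0 ≤ b k * min 1 (l k * |h|) := fun k h =>
    mul_nonneg (hb0 k) (le_min zero_le_one (mul_nonneg (hl k) (abs_nonneg h)))
  have hΩsum : ∀ h, Summable fun k => b k * min 1 (l k * |h|) := fun h =>
    hb.of_nonneg_of_le (fun k => hmin0 k h)
      fun k => mul_le_of_le_one_right (hb0 k) (min_le_left _ _)
  have hcont : ∀ s ∈ boundedModulusSet η Ω, Continuous fun t => m (s t) := fun s hs =>
    hm.continuousOn.comp_continuous (boundedModulusSet.continuous hs hΩ) fun t => (hs.1 t).1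
  have hex : ∀ s k, s ∈ boundedModulusSet η Ω → ∃ u p : ℝ → ℝ, u 0 = u0 k ∧ p 0 = u1 k ∧
      (∀ t, HasDerivAt u (p t) t) ∧
      ∀ t, HasDerivAt p (-(2 * d k * p t) - m (s t) * l k ^ 2 * u t) t := fun s k hs =>
    exists_damped_solution (hcont s hs) (fun t => hmM _ (hs.1 t)) _ _ _ _
  choose! u p hu0 hp0 hu hp using hex
  have hE : ∀ s, s ∈ boundedModulusSet η Ω → ∀ k t, 0 ≤ t →
      p s k t ^ 2 + l k ^ 2 * u s k t ^ 2 ≤ b k := fun s hs k =>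
    hen s hs (hcont s hs) k _ _ (hu0 s k hs) (hp0 s k hs) (hu s k hs) (hp s k hs)
  have hEu : ∀ s, s ∈ boundedModulusSet η Ω → ∀ k t, 0 ≤ t → l k ^ 2 * u s k t ^ 2 ≤ b k :=
    fun s hs k t ht => by nlinarith [hE s hs k t ht, sq_nonneg (p s k t)]
  have hsum : ∀ s, s ∈ boundedModulusSet η Ω → ∀ t, 0 ≤ t →
      Summable fun k => l k ^ 2 * u s k t ^ 2 := fun s hs t ht =>
    hb.of_nonneg_of_le (fun k => by positivity) fun k => hEu s hs k t ht
  have hclose : ∀ s ∈ boundedModulusSet η Ω, ∀ s' ∈ boundedModulusSet η Ω, ∀ k T ρ, 0 ≤ T →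
      (∀ t, 0 ≤ t → t ≤ T → |m (s t) - m (s' t)| ≤ ρ) →
      (u s k T - u s' k T) ^ 2 ≤
        ρ ^ 2 * (l k ^ 2 * b k * T * Real.exp ((2 + M * l k ^ 2) * T)) :=
    fun s hs s' hs' k T ρ hT hρ =>
    sq_sub_le_of_coeff_close (hd k) (hu s k hs) (hp s k hs) (hu s' k hs') (hp s' k hs')
      ((hu0 s k hs).trans (hu0 s' k hs').symm) ((hp0 s k hs).trans (hp0 s' k hs').symm)
      (fun t => hmM _ (hs'.1 t)) (hEu s hs k) hT hρ
  let Φ : (ℝ → ℝ) → ℝ → ℝ := fun s t => ∑' k, l k ^ 2 * u s k (max t 0) ^ 2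
  have ha0 : 0 ≤ ∑' k, l k ^ 2 * u0 k ^ 2 := tsum_nonneg fun k => by positivity
  have hbu0 : ∀ k, l k ^ 2 * u0 k ^ 2 ≤ b k := fun k => by
    nlinarith [hb1 k, sq_nonneg (u1 k)]
  have haη : ∑' k, l k ^ 2 * u0 k ^ 2 ≤ η :=
    ((hb.of_nonneg_of_le (fun k => by positivity) hbu0).tsum_le_tsum hbu0 hb).trans hbη
  obtain ⟨s, hs, hfix⟩ := exists_fixedPoint_of_causal (Φ := Φ) hΩ
    (a := ∑' k, l k ^ 2 * u0 k ^ 2)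
    ⟨fun _ => ⟨ha0, haη⟩, fun t τ => by
      rw [sub_self, abs_zero]; exact tsum_nonneg fun k => hmin0 k _⟩
    (by
      intro s hs
      refine ⟨fun t => ⟨tsum_nonneg fun k => by positivity, ?_⟩, fun t τ => ?_⟩
      · exact ((hsum s hs _ (le_max_right t 0)).tsum_le_tsum
          (fun k => hEu s hs k _ (le_max_right t 0)) hb).trans hbη
      · have h1 := hsum s hs _ (le_max_right t 0)
        have h2 := hsum s hs _ (le_max_right τ 0)
        simp only [Φ]
        rw [← h1.tsum_sub h2, ← Real.norm_eq_abs]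
        refine tsum_of_norm_bounded (hΩsum (t - τ)).hasSum fun k => ?_
        refine (abs_mul_sq_sub_le (hl k) (hu s k hs) (hE s hs k) (le_max_right t 0)
          (le_max_right τ 0)).trans ?_
        refine mul_le_mul_of_nonneg_left (min_le_min le_rfl ?_) (hb0 k)
        exact mul_le_mul_of_nonneg_left (abs_max_sub_max_le_abs t τ 0) (hl k))
    (by
      intro s hs t ht
      simp only [Φ, max_eq_right ht, hu0 s _ hs])
    (by
      intro s hs s' hs' T hT t ht
      simp only [Φ]
      refine tsum_congr fun k => ?_
      rcases le_total t 0 with ht0 | ht0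
      · rw [max_eq_right ht0, hu0 s k hs, hu0 s' k hs']
      have h1 := hclose s hs s' hs' k (max t 0) 0 (le_max_right _ _) fun r _ hrt => by
        rw [max_eq_left ht0] at hrt
        rw [hT r (hrt.trans ht), sub_self, abs_zero]
      have h2 : u s k (max t 0) - u s' k (max t 0) = 0 := by
        refine pow_eq_zero_iff (two_ne_zero) |>.1 (le_antisymm ?_ (sq_nonneg _))
        simpa using h1
      rw [sub_eq_zero.1 h2])
    (by
      intro f w hw s hs hunif t
      simp only [Φ]
      set T := max t 0
      have hT : 0 ≤ T := le_max_right _ _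
      refine tendsto_tsum_of_dominated_convergence hb (fun k => ?_)
        (Eventually.of_forall fun n k => ?_)
      · set C := l k ^ 2 * b k * T * Real.exp ((2 + M * l k ^ 2) * T) with hC
        have hC0 : 0 ≤ C := by have := hb0 k; positivity
        have hlim : Tendsto (fun n => u (w n) k T) f (𝓝 (u s k T)) := by
          rw [Metric.tendsto_nhds]
          intro ε hε
          obtain ⟨ρ, hρ, hρC⟩ : ∃ ρ > 0, ρ ^ 2 * C < ε ^ 2 := by
            refine ⟨ε / (C + 1), by positivity, ?_⟩
            rw [div_pow, div_mul_eq_mul_div, div_lt_iff₀ (by positivity)]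
            refine mul_lt_mul_of_pos_left ?_ (by positivity)
            nlinarith
          obtain ⟨r, hr, hmr⟩ := Metric.uniformContinuousOn_iff.1 hm ρ hρ
          filter_upwards [Metric.tendstoUniformlyOn_iff.1 (hunif T) r hr] with n hn
          have h1 := hclose (w n) (hw n) s hs k T ρ hT fun x hx hxT => by
            have := hmr _ ((hw n).1 x).1 _ (hs.1 x).1 (by
              rw [dist_comm]; exact hn x ⟨hx, hxT⟩)
            exact this.le
          exact abs_lt_of_sq_lt_sq (h1.trans_lt hρC) hε.le
        exact (hlim.pow 2).const_mul _
      · rw [Real.norm_of_nonneg (by positivity)]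
        exact hEu (w n) (hw n) k T hT)
  refine ⟨s, u s, p s, hcont s hs, fun t ht => ?_, fun k =>
    ⟨hu0 s k hs, hp0 s k hs, hu s k hs, hp s k hs, hE s hs k⟩⟩
  rw [← hfix t]
  simp only [Φ, max_eq_left ht]

/-- A curve with continuous components, dominated locally uniformly in time by a square summable
sequence, is continuous with values in `ℓ²`. -/
lemma l2Cont_of_dominated {v : ℝ → ℕ → ℝ} (hv : ∀ k, Continuous fun t => v t k)
    (hb : ∀ T : ℝ, ∃ b : ℕ → ℝ, Summable b ∧ ∀ t, 0 ≤ t → t ≤ T → ∀ k, v t k ^ 2 ≤ b k) :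
    L2Cont (Ici 0) v := by
  refine ⟨fun t ht => ?_, fun t ht ε hε => ?_⟩
  · obtain ⟨b, hbs, hb⟩ := hb t
    exact hbs.of_nonneg_of_le (fun k => sq_nonneg _) (hb t ht le_rfl)
  · obtain ⟨b, hbs, hb⟩ := hb (t + 1)
    have hlim : Tendsto (fun s => ∑' k, (v s k - v t k) ^ 2) (𝓝[Ici 0] t)
        (𝓝 (∑' _ : ℕ, (0:ℝ))) := by
      refine tendsto_tsum_of_dominated_convergence (hbs.mul_left 4) (fun k => ?_) ?_
      · have h1 : Continuous fun s => (v s k - v t k) ^ 2 := by have := hv k; fun_prop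
        have h2 := h1.tendsto t
        simp only [sub_self, ne_eq, OfNat.ofNat_ne_zero, not_false_eq_true, zero_pow] at h2
        exact h2.mono_left nhdsWithin_le_nhds
      · have h1 : ∀ᶠ s in 𝓝[Ici 0] t, s < t + 1 :=
          nhdsWithin_le_nhds (gt_mem_nhds (by linarith))
        filter_upwards [h1, self_mem_nhdsWithin] with s hs hs0 k
        rw [Real.norm_of_nonneg (sq_nonneg _)]
        have h2 := hb s hs0 hs.le k
        have h3 := hb t ht (by linarith) k
        nlinarith [sq_nonneg (v s k + v t k)]
    rw [tsum_zero] at hlim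
    obtain ⟨η, hη, h⟩ := Metric.mem_nhdsWithin_iff.1 (hlim (gt_mem_nhds hε))
    exact ⟨η, hη, fun s hs hst => h ⟨by simpa [Real.dist_eq] using hst, hs⟩⟩

lemma L2Cont.congr {I : Set ℝ} {v w : ℝ → ℕ → ℝ} (hv : L2Cont I v)
    (h : ∀ t ∈ I, ∀ k, v t k = w t k) : L2Cont I w := by
  refine ⟨fun t ht => ?_, fun t ht ε hε => ?_⟩
  · exact (hv.1 t ht).congr fun k => by rw [h t ht]
  · obtain ⟨η, hη, H⟩ := hv.2 t ht ε hε
    refine ⟨η, hη, fun s hs hst => ?_⟩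
    have := H s hs hst
    rwa [tsum_congr fun k => by rw [h s hs k, h t ht k]] at this

lemma IsModulus.nonneg {ω : ℝ → ℝ} (hω : IsModulus ω) {x : ℝ} (hx : 0 ≤ x) : 0 ≤ ω x := by
  have := hω.2.2.2.1 0 x le_rfl hx
  rwa [hω.2.1] at this

lemma IsModulus.exists_lt {ω : ℝ → ℝ} (hω : IsModulus ω) {κ : ℝ} (hκ : 0 < κ) :
    ∃ r > 0, ∀ x, 0 ≤ x → x < r → ω x < κ := by
  have h1 := hω.1 0 (mem_Ici.2 le_rfl)
  rw [ContinuousWithinAt, hω.2.1] at h1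
  obtain ⟨r, hr, h⟩ := Metric.mem_nhdsWithin_iff.1 (h1 (gt_mem_nhds hκ))
  exact ⟨r, hr, fun x hx hxr => h ⟨by simpa [Real.dist_eq, abs_of_nonneg hx] using hxr, hx⟩⟩

/-- Under the compatibility condition between `ω` and the exponents, a function with small
`4α`-Hölder constant is mapped by `ω` to one with small `(1 - 2σ)`-Hölder constant. -/
lemma IsModulus.exists_holder_bound {ω : ℝ → ℝ} (hω : IsModulus ω) {σ α κ : ℝ}
    (hσ : σ ≤ 1 / 2) (hα0 : 0 ≤ α) (hκ : 0 < κ)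
    (hlimsup : ∃ C : ℝ, ∀ᶠ x in 𝓝[>] (0:ℝ), ω x ^ (4 * α) / x ^ (1 - 2 * σ) ≤ C) :
    ∃ η > 0, ∀ x, 0 ≤ x → x ≤ η → ω x ≤ κ ∧
      ∀ h, 0 ≤ h → x ≤ η * h ^ (4 * α) → ω x ≤ κ * h ^ (1 - 2 * σ) := by
  obtain ⟨r₁, hr₁, hωr₁⟩ := hω.exists_lt hκ
  rcases hσ.eq_or_lt with hσe | hσl
  · refine ⟨r₁ / 2, by positivity, fun x hx hxr => ?_⟩
    have h1 : ω x ≤ κ := (hωr₁ x hx (by linarith)).le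
    refine ⟨h1, fun h _ _ => ?_⟩
    have : 1 - 2 * σ = 0 := by linarith
    rwa [this, Real.rpow_zero, mul_one]
  set β := 1 - 2 * σ with hβ
  have hβ0 : 0 < β := by linarith
  obtain ⟨C₀, hC₀⟩ := hlimsup
  set C := max C₀ 1 with hC
  have hCpos : 0 < C := lt_of_lt_of_le one_pos (le_max_right _ _)
  obtain ⟨r₂, hr₂, hr₂C⟩ := mem_nhdsGT_iff_exists_Ioo_subset.1 hC₀
  have hr₂0 : 0 < r₂ := hr₂
  have hbd : ∀ x, 0 < x → x < r₂ → ω x ^ (4 * α) ≤ C * x ^ β := by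
    intro x hx hxr
    have h1 : ω x ^ (4 * α) / x ^ β ≤ C₀ := hr₂C ⟨hx, hxr⟩
    have h2 := h1.trans (le_max_left C₀ 1)
    rwa [div_le_iff₀ (by positivity)] at h2
  have hlim : Tendsto (fun x : ℝ => C * x ^ β) (𝓝[>] 0) (𝓝 0) := by
    have h1 : Tendsto (fun x : ℝ => x ^ β) (𝓝 0) (𝓝 ((0:ℝ) ^ β)) :=
      (Real.continuousAt_rpow_const 0 β (Or.inr hβ0.le)).tendsto
    rw [Real.zero_rpow hβ0.ne'] at h1
    simpa using (h1.const_mul C).mono_left nhdsWithin_le_nhds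
  have hpos : ∀ᶠ x in 𝓝[>] (0:ℝ), 0 < x := self_mem_nhdsWithin
  have hlt : ∀ r : ℝ, 0 < r → ∀ᶠ x in 𝓝[>] (0:ℝ), x < r := fun r hr =>
    nhdsWithin_le_nhds (gt_mem_nhds hr)
  have hα : 0 < α := by
    refine lt_of_le_of_ne hα0 fun h0 => ?_
    obtain ⟨x, hx, hx0, hxr⟩ := ((hlim.eventually (gt_mem_nhds one_pos)).and (hpos.and (hlt r₂ hr₂0))).exists
    have h1 := hbd x hx0 hxr
    rw [← h0, mul_zero, Real.rpow_zero] at h1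
    have : C * x ^ β < 1 := hx
    linarith
  have hκα : 0 < κ ^ (4 * α) := by positivity
  obtain ⟨η, hη, hη0, hηr₁, hηr₂⟩ := ((hlim.eventually (gt_mem_nhds hκα)).and
    (hpos.and ((hlt r₁ hr₁).and (hlt r₂ hr₂0)))).exists
  have hη' : C * η ^ β < κ ^ (4 * α) := hη
  refine ⟨η, hη0, fun x hx hxη => ⟨(hωr₁ x hx (by linarith)).le, fun h hh hxh => ?_⟩⟩
  rcases hx.eq_or_lt with h0 | hxpos
  · rw [← h0, hω.2.1]; positivity
  · have h1 := hbd x hxpos (by linarith)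
    rw [← Real.rpow_le_rpow_iff (hω.nonneg hx) (by positivity) (by positivity : 0 < 4 * α)]
    calc ω x ^ (4 * α) ≤ C * x ^ β := h1
      _ ≤ C * (η * h ^ (4 * α)) ^ β :=
        mul_le_mul_of_nonneg_left (Real.rpow_le_rpow hx hxh hβ0.le) hCpos.le
      _ = C * η ^ β * (h ^ β) ^ (4 * α) := by
        rw [Real.mul_rpow hη0.le (by positivity), ← Real.rpow_mul hh, ← Real.rpow_mul hh,
          mul_comm (4 * α) β, mul_assoc]
      _ ≤ κ ^ (4 * α) * (h ^ β) ^ (4 * α) :=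
        mul_le_mul_of_nonneg_right hη'.le (by positivity)
      _ = (κ * h ^ β) ^ (4 * α) := (Real.mul_rpow hκ.le (by positivity)).symm

lemma min_one_le_rpow {x r : ℝ} (hx : 0 ≤ x) (hr0 : 0 ≤ r) (hr1 : r ≤ 1) : min 1 x ≤ x ^ r := by
  rcases le_total x 1 with h | h
  · refine (min_le_right _ _).trans ?_
    rcases hx.eq_or_lt with h0 | h0
    · rw [← h0]; positivity
    · simpa using Real.rpow_le_rpow_of_exponent_ge h0 h hr1
  · exact (min_le_left _ _).trans (Real.one_le_rpow h hr0)

lemma sq_le_two_mul_add {u p : ℝ → ℝ} {b : ℝ} (hu : ∀ t, HasDerivAt u (p t) t)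
    (hb : ∀ t, 0 ≤ t → p t ^ 2 ≤ b) {t T : ℝ} (ht : 0 ≤ t) (htT : t ≤ T) :
    u t ^ 2 ≤ 2 * u 0 ^ 2 + 2 * (T ^ 2 * b) := by
  have hb0 : 0 ≤ b := (sq_nonneg _).trans (hb 0 le_rfl)
  have h1 := (convex_Ici (0:ℝ)).norm_image_sub_le_of_norm_hasDerivWithin_le (C := √b)
    (fun r _ => (hu r).hasDerivWithinAt) (fun r hr => Real.abs_le_sqrt (hb r hr))
    (mem_Ici.2 le_rfl) ht
  rw [sub_zero, Real.norm_eq_abs, Real.norm_eq_abs, abs_of_nonneg ht] at h1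
  have h2 : (u t - u 0) ^ 2 ≤ T ^ 2 * b := by
    calc (u t - u 0) ^ 2 = |u t - u 0| ^ 2 := (sq_abs _).symm
      _ ≤ (√b * t) ^ 2 := pow_le_pow_left₀ (abs_nonneg _) h1 2
      _ = t ^ 2 * b := by rw [mul_pow, Real.sq_sqrt hb0, mul_comm]
      _ ≤ T ^ 2 * b := mul_le_mul_of_nonneg_right (pow_le_pow_left₀ ht htT 2) hb0
  nlinarith [sq_nonneg (u t - 2 * u 0)]

/-- Subcritical dissipation: global existence for small data in `D(A^{α+1/2}) × D(A^α)`
for the Kirchhoff equation with strong damping `A^σ u'`, `σ ∈ (0,1/2]`. -/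
theorem global_existence_small_data_subcritical
    (μ₁ : ℝ) (hμ₁ : 0 < μ₁)
    (m : ℝ → ℝ) (hmlb : ∀ x : ℝ, 0 ≤ x → μ₁ ≤ m x)
    (ωm : ℝ → ℝ) (hωm : IsModulus ωm)
    (hmc : ∀ a b : ℝ, 0 ≤ a → 0 ≤ b → |m a - m b| ≤ ωm |a - b|)
    (σ δ : ℝ) (hσ0 : 0 < σ) (hσ : σ ≤ 1 / 2) (hδ : 0 < δ)
    (α : ℝ) (hα0 : 0 ≤ α) (hα1 : α < 1 / 4)
    (hlimsup : ∃ C : ℝ, ∀ᶠ x in 𝓝[>] (0:ℝ), ωm x ^ (4 * α) / x ^ (1 - 2 * σ) ≤ C) :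
    ∃ ε₀ > (0:ℝ), ∀ lam : ℕ → ℝ, (∀ k, 0 ≤ lam k) →
      ∀ u0 u1 : ℕ → ℝ,
        (Summable fun k => u0 k ^ 2) →
        (Summable fun k => lam k ^ (4 * α + 2) * u0 k ^ 2) →
        (Summable fun k => u1 k ^ 2) →
        (Summable fun k => lam k ^ (4 * α) * u1 k ^ 2) →
        (∑' k, u1 k ^ 2) + (∑' k, lam k ^ 2 * u0 k ^ 2) +
          (∑' k, lam k ^ (4 * α) * u1 k ^ 2) +
          (∑' k, lam k ^ (4 * α + 2) * u0 k ^ 2) ≤ ε₀ →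
        ∃ u : ℕ → ℝ → ℝ,
          IsKirchhoffSol lam m σ δ (Ici 0) u0 u1 u ∧
          L2Cont (Ici 0) (fun t k => lam k ^ (2 * α + 1) * u k t) ∧
          L2Cont (Ici 0) (fun t k => lam k ^ (2 * α) * derivWithin (u k) (Ici 0) t) := by
  have hμm : μ₁ ≤ m 0 := hmlb 0 le_rfl
  obtain ⟨κ, hκ, hκ1, K₀, hK₀, henergy⟩ :=
    exists_uniform_energy_bound (μ' := m 0) hμ₁ hσ0 hσ hδ
  obtain ⟨η, hη, hωη⟩ := hωm.exists_holder_bound hσ hα0 hκ hlimsup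
  set K := K₀ + 1 with hK
  have hKpos : 0 < K := by positivity
  have hmuc : UniformContinuousOn m (Ici 0) := by
    rw [Metric.uniformContinuousOn_iff]
    intro ε hε
    obtain ⟨r, hr, hωr⟩ := hωm.exists_lt hε
    exact ⟨r, hr, fun x hx y hy hxy => (hmc x y hx hy).trans_lt (hωr _ (abs_nonneg _) hxy)⟩
  have hm0 : ∀ x ∈ Icc 0 η, |m x - m 0| ≤ κ := fun x hx => by
    refine (hmc x 0 hx.1 le_rfl).trans ?_
    rw [sub_zero, abs_of_nonneg hx.1]
    exact (hωη x hx.1 hx.2).1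
  refine ⟨η / K, by positivity, ?_⟩
  intro lam hlam u0 u1 hu0 hu0w hu1 hu1w hsmall
  have hsplit : ∀ k, lam k ^ (4 * α + 2) = lam k ^ (4 * α) * lam k ^ 2 := fun k => by
    rw [Real.rpow_add_of_nonneg (hlam k) (by linarith) (by norm_num)]
    norm_num
  have hu0l : Summable fun k => lam k ^ 2 * u0 k ^ 2 := by
    refine (hu0.add hu0w).of_nonneg_of_le (fun k => by positivity) fun k => ?_
    rw [← one_add_mul]
    refine mul_le_mul_of_nonneg_right ?_ (sq_nonneg _)
    have hw : 0 ≤ lam k ^ (4 * α) := Real.rpow_nonneg (hlam k) _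
    rw [hsplit]
    rcases le_total (lam k) 1 with h | h
    · have h1 : lam k ^ 2 ≤ 1 := pow_le_one₀ (hlam k) h
      have h2 : 0 ≤ lam k ^ (4 * α) * lam k ^ 2 := by positivity
      linarith
    · have h1 : 1 ≤ lam k ^ (4 * α) := Real.one_le_rpow h (by linarith)
      nlinarith [sq_nonneg (lam k)]
  set b : ℕ → ℝ := fun k => K * (u1 k ^ 2 + lam k ^ 2 * u0 k ^ 2) with hbdef
  have hb0 : ∀ k, 0 ≤ b k := fun k => by positivity
  have hb : Summable b := (hu1.add hu0l).mul_left K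
  have hwb : ∀ k, lam k ^ (4 * α) * b k =
      K * (lam k ^ (4 * α) * u1 k ^ 2 + lam k ^ (4 * α + 2) * u0 k ^ 2) := fun k => by
    rw [hsplit]; simp only [hbdef]; ring
  have hbw : Summable fun k => lam k ^ (4 * α) * b k :=
    ((hu1w.add hu0w).mul_left K).congr fun k => (hwb k).symm
  have hw0 : ∀ k, 0 ≤ lam k ^ (4 * α) := fun k => Real.rpow_nonneg (hlam k) _
  have p1 : 0 ≤ ∑' k, u1 k ^ 2 := tsum_nonneg fun k => sq_nonneg _
  have p2 : 0 ≤ ∑' k, lam k ^ 2 * u0 k ^ 2 := tsum_nonneg fun k => by positivity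
  have p3 : 0 ≤ ∑' k, lam k ^ (4 * α) * u1 k ^ 2 :=
    tsum_nonneg fun k => mul_nonneg (hw0 k) (sq_nonneg _)
  have p4 : 0 ≤ ∑' k, lam k ^ (4 * α + 2) * u0 k ^ 2 :=
    tsum_nonneg fun k => mul_nonneg (Real.rpow_nonneg (hlam k) _) (sq_nonneg _)
  have hbη : ∑' k, b k ≤ η := by
    simp only [hbdef]
    rw [tsum_mul_left, hu1.tsum_add hu0l, mul_comm, ← le_div_iff₀ hKpos]
    linarith
  have hbwη : ∑' k, lam k ^ (4 * α) * b k ≤ η := by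
    rw [tsum_congr hwb, tsum_mul_left, hu1w.tsum_add hu0w, mul_comm, ← le_div_iff₀ hKpos]
    linarith
  have hKbound : ∀ k, K₀ * (u1 k ^ 2 + lam k ^ 2 * u0 k ^ 2) ≤ b k := fun k =>
    mul_le_mul_of_nonneg_right (by linarith) (by positivity)
  obtain ⟨s, u, p, hms, hs, hup⟩ := exists_kirchhoff_components (m := m) (M := m 0 + κ) (η := η)
    (l := lam) (d := fun k => δ * lam k ^ (2 * σ)) (b := b) (u0 := u0) (u1 := u1) hlam
    (fun k => mul_nonneg hδ.le (Real.rpow_nonneg (hlam k) _)) hb hbη hmuc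
    (fun x hx => by
      rw [abs_of_pos (hμ₁.trans_le (hmlb x hx.1))]
      have := (abs_le.1 (hm0 x hx)).2
      linarith)
    (fun k => le_mul_of_one_le_left (by positivity) (by linarith))
    (by
      intro s hs hcont k u p h0 h1 hu hp t ht
      have hhol : ∀ t τ, |s t - s τ| ≤ η * |t - τ| ^ (4 * α) := by
        intro t τ
        refine (hs.2 t τ).trans ?_
        have hle : ∀ k, b k * min 1 (lam k * |t - τ|) ≤
            lam k ^ (4 * α) * b k * |t - τ| ^ (4 * α) := fun k => by
          have h1 := min_one_le_rpow (mul_nonneg (hlam k) (abs_nonneg (t - τ)))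
            (by linarith : 0 ≤ 4 * α) (by linarith)
          rw [Real.mul_rpow (hlam k) (abs_nonneg _)] at h1
          calc _ ≤ b k * (lam k ^ (4 * α) * |t - τ| ^ (4 * α)) :=
                mul_le_mul_of_nonneg_left h1 (hb0 k)
            _ = _ := by ring
        have hsum : Summable fun k => b k * min 1 (lam k * |t - τ|) :=
          hb.of_nonneg_of_le (fun k => mul_nonneg (hb0 k)
            (le_min zero_le_one (mul_nonneg (hlam k) (abs_nonneg _))))
            fun k => mul_le_of_le_one_right (hb0 k) (min_le_left _ _)
        refine (hsum.tsum_le_tsum hle (hbw.mul_right _)).trans ?_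
        rw [tsum_mul_right]
        exact mul_le_mul_of_nonneg_right hbwη (by positivity)
      have hdiff : ∀ t τ, |s t - s τ| ≤ η := fun t τ => by
        have h1 := hs.1 t
        have h2 := hs.1 τ
        rw [abs_le]
        constructor <;> linarith [h1.1, h1.2, h2.1, h2.2]
      have := henergy (fun t => m (s t)) (m 0) hcont (fun t => hmlb _ (hs.1 t).1) hμm le_rfl
        (fun t => hm0 _ (hs.1 t))
        (fun t τ => (hmc _ _ (hs.1 t).1 (hs.1 τ).1).trans
          ((hωη _ (abs_nonneg _) (hdiff t τ)).2 _ (abs_nonneg _) (hhol t τ)))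
        (lam k) u p (hlam k) hu hp t ht
      rw [h0, h1] at this
      exact this.trans (hKbound k))
  have hu : ∀ k t, HasDerivAt (u k) (p k t) t := fun k => (hup k).2.2.1
  have hp := fun k => (hup k).2.2.2.1
  have hE := fun k => (hup k).2.2.2.2
  have hEp : ∀ k t, 0 ≤ t → p k t ^ 2 ≤ b k := fun k t ht => by
    have : 0 ≤ lam k ^ 2 * u k t ^ 2 := by positivity
    linarith [hE k t ht]
  have hEu : ∀ k t, 0 ≤ t → lam k ^ 2 * u k t ^ 2 ≤ b k := fun k t ht => by
    linarith [hE k t ht, sq_nonneg (p k t)]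
  have huc : ∀ k, Continuous (u k) := fun k =>
    continuous_iff_continuousAt.2 fun t => (hu k t).continuousAt
  have hpc : ∀ k, Continuous (p k) := fun k =>
    continuous_iff_continuousAt.2 fun t => (hp k t).continuousAt
  have hdu : ∀ k, ∀ t ∈ Ici (0:ℝ), derivWithin (u k) (Ici 0) t = p k t := fun k t ht =>
    (hu k t).hasDerivWithinAt.derivWithin (uniqueDiffOn_Ici 0 t ht)
  have hwsq : ∀ k, (lam k ^ (2 * α)) ^ 2 = lam k ^ (4 * α) := fun k => by
    rw [← Real.rpow_natCast, ← Real.rpow_mul (hlam k)]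
    congr 1
    push_cast
    ring
  refine ⟨u, ⟨fun k => ?_, fun k => (hup k).1, fun k => ?_, fun k t ht => ?_, ?_, ?_, ?_⟩, ?_, ?_⟩
  · refine ContDiff.contDiffOn ?_
    have h1 : deriv (u k) = p k := funext fun t => (hu k t).deriv
    have h2 : deriv (p k) =
        fun t => -(2 * (δ * lam k ^ (2 * σ)) * p k t) - m (s t) * lam k ^ 2 * u k t :=
      funext fun t => (hp k t).deriv
    have h3 : ContDiff ℝ 1 (p k) := by
      rw [contDiff_one_iff_deriv]
      refine ⟨fun t => (hp k t).differentiableAt, ?_⟩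
      rw [h2]
      exact ((hpc k).const_mul _).neg.sub ((hms.mul_const _).mul (huc k))
    rw [show (2 : WithTop ℕ∞) = 1 + 1 by norm_num, contDiff_succ_iff_deriv]
    exact ⟨fun t => (hu k t).differentiableAt, by simp, by rwa [h1]⟩
  · rw [hdu k 0 (mem_Ici.2 le_rfl), (hup k).2.1]
  · rw [derivWithin_congr (hdu k) (hdu k t ht), hdu k t ht, ← hs t ht,
      (hp k t).hasDerivWithinAt.derivWithin (uniqueDiffOn_Ici 0 t ht)]
    ring
  · refine l2Cont_of_dominated huc fun T => ⟨fun k => 2 * u0 k ^ 2 + 2 * (T ^ 2 * b k),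
      (hu0.mul_left 2).add ((hb.mul_left _).mul_left 2), fun t ht htT k => ?_⟩
    have := sq_le_two_mul_add (hu k) (hEp k) ht htT
    rwa [(hup k).1] at this
  · refine l2Cont_of_dominated (fun k => (huc k).const_mul _) fun T => ⟨b, hb, fun t ht _ k => ?_⟩
    rw [mul_pow]
    exact hEu k t ht
  · refine (l2Cont_of_dominated hpc fun T => ⟨b, hb, fun t ht _ k => hEp k t ht⟩).congr
      fun t ht k => (hdu k t ht).symm
  · refine l2Cont_of_dominated (fun k => (huc k).const_mul _) fun T =>
      ⟨_, hbw, fun t ht _ k => ?_⟩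
    rw [Real.rpow_add_one' (hlam k) (by linarith), mul_pow, mul_pow, hwsq, mul_assoc]
    exact mul_le_mul_of_nonneg_left (hEu k t ht) (hw0 k)
  · refine (l2Cont_of_dominated (v := fun t k => lam k ^ (2 * α) * p k t)
      (fun k => (hpc k).const_mul _) fun T => ⟨_, hbw, fun t ht _ k => ?_⟩).congr
      fun t ht k => by rw [hdu k t ht]
    rw [mul_pow, hwsq]
    exact mul_le_mul_of_nonneg_left (hEp k t ht) (hw0 k)
end
end

section
/- Let T > 0, let λ : ℕ → [0,∞) be a sequence, and let c_n : [0,T] → ℝ (n ∈ ℕ) be measurable functions satisfying 0 ≤ c_n(t) ≤ μ₂ for all t, converging pointwise on [0,T] to a function c_∞ : [0,T] → ℝ. Let σ and δ be positive real numbers such that either σ > 1/2, or σ = 1/2 and 4δ² ≥ μ₂. Let (u⁰,u¹) ∈ D(A^{1/2}) × H, let u_n be a solution on [0,T] of the linear equation u'' + 2δ A^σ u' + c_n(t) A u = 0 with initial data (u⁰,u¹), and let u_∞ be a solution on [0,T] of the same equation with coefficient c_∞ and the same initial data. Then sup_{t∈[0,T]} ( |u_∞'(t) − u_n'(t)|²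 + |A^{1/2}(u_∞(t) − u_n(t))|² ) → 0 as n → ∞. -/
open Set Filter MeasureTheory Topology

noncomputable section

/-- A solution on `[0,T]` of the linear equation `u'' + 2δ A^σ u' + c(t) A u = 0` with
initial data `(u0, u1)`, in the diagonal setting.  Each component `u k` is `C¹` with
derivative `v k`, and `v k` is absolutely continuous with the equation holding a.e.,
which is encoded through the integral formulation; moreover the curves `t ↦ u(t)`,
`t ↦ A^{1/2}u(t)`, `t ↦ u'(t)` are continuous with values in `ℓ²`. -/
def IsLinearSol (lam : ℕ → ℝ) (c : ℝ → ℝ) (σ δ : ℝ) (T : ℝ)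
    (u0 u1 : ℕ → ℝ) (u v : ℕ → ℝ → ℝ) : Prop :=
  (∀ k, u k 0 = u0 k) ∧
  (∀ k, v k 0 = u1 k) ∧
  (∀ k, ∀ t ∈ Icc (0:ℝ) T, HasDerivWithinAt (u k) (v k t) (Icc 0 T) t) ∧
  (∀ k, ∀ t ∈ Icc (0:ℝ) T, v k t = u1 k - ∫ s in (0:ℝ)..t,
      (2 * δ * lam k ^ (2 * σ) * v k s + c s * lam k ^ 2 * u k s)) ∧
  L2Cont (Icc 0 T) (fun t k => u k t) ∧
  L2Cont (Icc 0 T) (fun t k => lam k * u k t) ∧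
  L2Cont (Icc 0 T) (fun t k => v k t)

/-- A differential form of Grönwall's inequality for absolutely continuous functions. -/
lemma AbsolutelyContinuousOnInterval.le_mul_exp {f : ℝ → ℝ} {K T : ℝ} (hT : 0 ≤ T)
    (hf : AbsolutelyContinuousOnInterval f 0 T)
    (hf' : ∀ᵐ t, t ∈ Icc 0 T → ∃ f', HasDerivAt f f' t ∧ f' ≤ K * f t) :
    ∀ t ∈ Icc 0 T, f t ≤ f 0 * Real.exp (K * t) := by
  intro t ht
  have hsub : Icc 0 t ⊆ Icc 0 T := Icc_subset_Icc_right ht.2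
  have hexp : AbsolutelyContinuousOnInterval (fun s => Real.exp (-K * s)) 0 t :=
    ContDiffOn.absolutelyContinuousOnInterval (by fun_prop)
  have hg := hexp.fun_mul (hf.mono (by rwa [uIcc_of_le ht.1, uIcc_of_le hT]))
  have hle : ∫ s in (0 : ℝ)..t, deriv (fun s => Real.exp (-K * s) * f s) s ≤ 0 := by
    have h : ∫ s in (0 : ℝ)..t, deriv (fun s => Real.exp (-K * s) * f s) s
        ≤ ∫ _ in (0 : ℝ)..t, (0 : ℝ) := by
      refine intervalIntegral.integral_mono_ae_restrict ht.1 hg.intervalIntegrable_deriv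
        (by simp) ?_
      rw [Filter.EventuallyLE, ae_restrict_iff' measurableSet_Icc]
      filter_upwards [hf'] with s hs hst
      obtain ⟨f', hd, hb⟩ := hs (hsub hst)
      have he : HasDerivAt (fun s => Real.exp (-K * s)) (Real.exp (-K * s) * (-K)) s := by
        simpa using ((hasDerivAt_id s).const_mul (-K)).exp
      rw [(he.fun_mul hd).deriv]
      nlinarith [Real.exp_pos (-K * s)]
    simpa using h
  rw [hg.integral_deriv_eq_sub] at hle
  have h1 : Real.exp (-K * t) * Real.exp (K * t) = 1 := by
    rw [← Real.exp_add]; simp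
  have h2 : Real.exp (-K * t) * f t ≤ f 0 := by simpa using hle
  calc f t = Real.exp (-K * t) * f t * Real.exp (K * t) := by linear_combination (-f t) * h1
    _ ≤ f 0 * Real.exp (K * t) := mul_le_mul_of_nonneg_right h2 (Real.exp_pos _).le

/-- Grönwall's inequality in integral form. -/
lemma le_mul_exp_of_le_add_integral {h : ℝ → ℝ} {a K T : ℝ} (hT : 0 ≤ T) (hK : 0 ≤ K)
    (hc : ContinuousOn h (Icc 0 T))
    (hle : ∀ t ∈ Icc 0 T, h t ≤ a + K * ∫ s in (0 : ℝ)..t, h s) :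
    ∀ t ∈ Icc 0 T, h t ≤ a * Real.exp (K * t) := by
  intro t ht
  have hint : IntervalIntegrable h volume 0 T :=
    ContinuousOn.intervalIntegrable (by rwa [uIcc_of_le hT])
  have hconst : AbsolutelyContinuousOnInterval (fun _ : ℝ => a) 0 T :=
    ContDiffOn.absolutelyContinuousOnInterval (by fun_prop)
  have hac : AbsolutelyContinuousOnInterval (fun t => a + K * ∫ s in (0 : ℝ)..t, h s) 0 T :=
    hconst.fun_add ((hint.absolutelyContinuousOnInterval_intervalIntegral (by simp)).const_mul K)
  have := hac.le_mul_exp (K := K) hT (by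
    filter_upwards [hint.ae_hasDerivAt_integral] with s hs hsT
    refine ⟨_, ((hs (by rwa [uIcc_of_le hT]) 0 (by simp)).const_mul K).const_add a, ?_⟩
    exact mul_le_mul_of_nonneg_left (hle s hsT) hK) t ht
  refine (hle t ht).trans (this.trans (by simp))

/-- A scalar Carathéodory solution on `[0,T]` of `u'' + b u' + q c(t) u = 0`, with `v = u'`. -/
structure IsModeSol (b q T : ℝ) (c u v : ℝ → ℝ) : Prop where
  hasDeriv : ∀ t ∈ Icc 0 T, HasDerivWithinAt u (v t) (Icc 0 T) t
  continuousOn_vel : ContinuousOn v (Icc 0 T)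
  vel_eq : ∀ t ∈ Icc 0 T, v t = v 0 - ∫ s in (0 : ℝ)..t, (b * v s + c s * q * u s)

namespace IsModeSol

variable {b q T M : ℝ} {c u v : ℝ → ℝ}

lemma continuousOn_pos (h : IsModeSol b q T c u v) : ContinuousOn u (Icc 0 T) :=
  fun t ht => (h.hasDeriv t ht).continuousWithinAt

lemma pos_eq (h : IsModeSol b q T c u v) : ∀ t ∈ Icc 0 T, u t = u 0 + ∫ s in (0 : ℝ)..t, v s := by
  intro t ht
  have hsub : Icc 0 t ⊆ Icc 0 T := Icc_subset_Icc_right ht.2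
  have := intervalIntegral.integral_eq_sub_of_hasDerivAt_of_le ht.1
    (h.continuousOn_pos.mono hsub)
    (fun s hs => (h.hasDeriv s (hsub (Ioo_subset_Icc_self hs))).hasDerivAt
      (Icc_mem_nhds hs.1 (hs.2.trans_le ht.2)))
    (ContinuousOn.intervalIntegrable (by
      rw [uIcc_of_le ht.1]; exact h.continuousOn_vel.mono hsub))
  rw [this]; ring

end IsModeSol

lemma intervalIntegrable_mul_of_bounded {T M : ℝ} {c f : ℝ → ℝ} (hT : 0 ≤ T)
    (hc : AEMeasurable c (volume.restrict (Icc 0 T))) (hb : ∀ t ∈ Icc 0 T, |c t| ≤ M)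
    (hf : ContinuousOn f (Icc 0 T)) : IntervalIntegrable (fun t => c t * f t) volume 0 T := by
  rw [intervalIntegrable_iff_integrableOn_Icc_of_le hT]
  refine Integrable.bdd_mul (c := M) (hf.integrableOn_compact isCompact_Icc)
    hc.aestronglyMeasurable ?_
  rw [ae_restrict_iff' measurableSet_Icc]
  exact Eventually.of_forall fun t ht => hb t ht

namespace IsModeSol

variable {b q T M : ℝ} {c u v : ℝ → ℝ}

lemma intervalIntegrable_force (h : IsModeSol b q T c u v) (hT : 0 ≤ T)
    (hc : AEMeasurable c (volume.restrict (Icc 0 T))) (hb : ∀ t ∈ Icc 0 T, |c t| ≤ M) :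
    IntervalIntegrable (fun s => b * v s + c s * q * u s) volume 0 T := by
  refine IntervalIntegrable.add (ContinuousOn.intervalIntegrable ?_) ?_
  · rw [uIcc_of_le hT]; exact h.continuousOn_vel.const_mul b
  · simpa only [mul_assoc] using
      intervalIntegrable_mul_of_bounded hT hc hb (h.continuousOn_pos.const_mul q)

/-- Exponential growth bound for a quadratic energy along a mode. -/
lemma energy_le (h : IsModeSol b q T c u v) (hT : 0 ≤ T)
    (hc : AEMeasurable c (volume.restrict (Icc 0 T))) (hb : ∀ t ∈ Icc 0 T, |c t| ≤ M)
    {α β K : ℝ}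
    (hQ : ∀ t ∈ Icc 0 T, ∀ x y : ℝ,
      2 * α * (x + β * y) * (y - β * (b * y + c t * q * x)) - 2 * y * (b * y + c t * q * x)
        ≤ K * (α * (x + β * y) ^ 2 + y ^ 2)) :
    ∀ t ∈ Icc 0 T, α * (u t + β * v t) ^ 2 + v t ^ 2
      ≤ (α * (u 0 + β * v 0) ^ 2 + v 0 ^ 2) * Real.exp (K * t) := by
  have hF := h.intervalIntegrable_force hT hc hb
  have hv : IntervalIntegrable v volume 0 T :=
    ContinuousOn.intervalIntegrable (by rw [uIcc_of_le hT]; exact h.continuousOn_vel)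
  have hconst (a : ℝ) : AbsolutelyContinuousOnInterval (fun _ : ℝ => a) 0 T :=
    ContDiffOn.absolutelyContinuousOnInterval (by fun_prop)
  let U : ℝ → ℝ := fun t => u 0 + ∫ s in (0 : ℝ)..t, v s
  let V : ℝ → ℝ := fun t => v 0 - ∫ s in (0 : ℝ)..t, (b * v s + c s * q * u s)
  have hU : AbsolutelyContinuousOnInterval U 0 T :=
    (hconst _).fun_add (hv.absolutelyContinuousOnInterval_intervalIntegral (by simp))
  have hV : AbsolutelyContinuousOnInterval V 0 T :=
    (hconst _).fun_sub (hF.absolutelyContinuousOnInterval_intervalIntegral (by simp))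
  have hZ := hU.fun_add (hV.const_mul β)
  have hG := ((hZ.fun_mul hZ).const_mul α).fun_add (hV.fun_mul hV)
  have key := hG.le_mul_exp (K := K) hT (by
    filter_upwards [hv.ae_hasDerivAt_integral, hF.ae_hasDerivAt_integral] with s h1 h2 hs
    have hs' : s ∈ uIcc 0 T := by rwa [uIcc_of_le hT]
    have dU : HasDerivAt U (v s) s := (h1 hs' 0 (by simp)).const_add _
    have dV : HasDerivAt V (-(b * v s + c s * q * u s)) s := (h2 hs' 0 (by simp)).const_sub _
    have dZ := dU.fun_add (dV.const_mul β)
    refine ⟨_, ((dZ.fun_mul dZ).const_mul α).fun_add (dV.fun_mul dV), ?_⟩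
    have eU : U s = u s := (h.pos_eq s hs).symm
    have eV : V s = v s := (h.vel_eq s hs).symm
    rw [eU, eV]
    linarith [hQ s hs (u s) (v s)])
  intro t ht
  have := key t ht
  have eU : U t = u t := (h.pos_eq t ht).symm
  have eV : V t = v t := (h.vel_eq t ht).symm
  have eU0 : U 0 = u 0 := by simp [U]
  have eV0 : V 0 = v 0 := by simp [V]
  rw [eU, eV, eU0, eV0] at this
  simpa only [sq] using this

/-- Energy bound for the low modes, where the damping is not dominant. -/
lemma low_bound {l : ℝ} (h : IsModeSol b (l ^ 2) T c u v) (hT : 0 ≤ T) (hl : 0 ≤ l)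
    (hb0 : 0 ≤ b) (hM : 0 ≤ M)
    (hc : AEMeasurable c (volume.restrict (Icc 0 T))) (hb : ∀ t ∈ Icc 0 T, 0 ≤ c t ∧ c t ≤ M) :
    ∀ t ∈ Icc 0 T, v t ^ 2 + l ^ 2 * u t ^ 2
      ≤ Real.exp (l * (1 + M) * T) * (l ^ 2 * u 0 ^ 2 + v 0 ^ 2) := by
  intro t ht
  have key := h.energy_le hT hc (M := M)
    (fun s hs => abs_le.2 ⟨by linarith [(hb s hs).1], (hb s hs).2⟩)
    (α := l ^ 2) (β := 0) (K := l * (1 + M)) (by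
      intro s hs x y
      obtain ⟨h0, h1⟩ := hb s hs
      have e : 2 * (l * x) * y * (l * (1 - c s)) ≤ ((l * x) ^ 2 + y ^ 2) * (l * (1 + M)) := by
        have a1 : |2 * (l * x) * y| ≤ (l * x) ^ 2 + y ^ 2 :=
          abs_le.2 ⟨by nlinarith [sq_nonneg (l * x + y)], by nlinarith [sq_nonneg (l * x - y)]⟩
        have a2 : |l * (1 - c s)| ≤ l * (1 + M) := by
          rw [abs_mul, abs_of_nonneg hl]
          exact mul_le_mul_of_nonneg_left (abs_le.2 ⟨by linarith, by linarith⟩) hl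
        calc _ ≤ |2 * (l * x) * y * (l * (1 - c s))| := le_abs_self _
          _ = |2 * (l * x) * y| * |l * (1 - c s)| := abs_mul _ _
          _ ≤ _ := mul_le_mul a1 a2 (abs_nonneg _) (by positivity)
      nlinarith [mul_nonneg hb0 (sq_nonneg y)]) t ht
  have hE : Real.exp (l * (1 + M) * t) ≤ Real.exp (l * (1 + M) * T) :=
    Real.exp_le_exp.2 (mul_le_mul_of_nonneg_left ht.2 (by positivity))
  have h0 : 0 ≤ l ^ 2 * u 0 ^ 2 + v 0 ^ 2 := by positivity
  simp only [zero_mul, add_zero] at key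
  nlinarith [mul_le_mul_of_nonneg_left hE h0]

/-- Energy bound for the overdamped modes, uniform in the frequency. -/
lemma high_bound (h : IsModeSol b q T c u v) (hT : 0 ≤ T) (hq : 0 ≤ q)
    (hb0 : 0 < b) (hM : 0 < M) (hover : M * q ≤ b ^ 2)
    (hc : AEMeasurable c (volume.restrict (Icc 0 T))) (hb : ∀ t ∈ Icc 0 T, 0 ≤ c t ∧ c t ≤ M) :
    ∀ t ∈ Icc 0 T, v t ^ 2 + q * u t ^ 2
      ≤ (1 + 4 / M) * (2 * M + 3) * (q * u 0 ^ 2 + v 0 ^ 2) := by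
  intro t ht
  obtain ⟨β, hβ⟩ : ∃ β, b * β = 1 := ⟨b⁻¹, mul_inv_cancel₀ hb0.ne'⟩
  have hβ0 : 0 < β := pos_of_mul_pos_right (by rw [hβ]; exact one_pos) hb0.le
  have hMqβ : M * q * β ^ 2 ≤ 1 := by
    calc M * q * β ^ 2 ≤ b ^ 2 * β ^ 2 := mul_le_mul_of_nonneg_right hover (sq_nonneg β)
      _ = 1 := by rw [← mul_pow, hβ, one_pow]
  have key := h.energy_le hT hc (M := M)
    (fun s hs => abs_le.2 ⟨by linarith [(hb s hs).1], (hb s hs).2⟩)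
    (α := M * q) (β := β) (K := 0) (by
      intro s hs x y
      obtain ⟨h0, h1⟩ := hb s hs
      obtain ⟨z, rfl⟩ : ∃ z, x = z - β * y := ⟨x + β * y, by ring⟩
      have hform : 0 ≤ c s * (M * (q * z) + (b - M * q * β) * y / 2) ^ 2
          + (M * (b ^ 2 - c s * q) - c s * (b - M * q * β) ^ 2 / 4) * y ^ 2 := by
        have hw0 : 0 ≤ b - M * q * β := by
          have : b - M * q * β = b * (1 - M * q * β ^ 2) := by
            linear_combination (M * q * β) * hβ
          rw [this]; exact mul_nonneg hb0.le (by linarith)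
        have hwb : b - M * q * β ≤ b := by
          have : 0 ≤ M * q * β := by positivity
          linarith
        have hcw : c s * (b - M * q * β) ^ 2 ≤ M * (b ^ 2 - c s * q) := by
          calc c s * (b - M * q * β) ^ 2 ≤ M * (b * (b - M * q * β)) := by
                refine mul_le_mul h1 ?_ (sq_nonneg _) hM.le
                rw [sq]; exact mul_le_mul_of_nonneg_right hwb hw0
            _ = M * (b ^ 2 - M * q) := by linear_combination (-M * M * q) * hβ
            _ ≤ M * (b ^ 2 - c s * q) := by
                have := mul_le_mul_of_nonneg_right h1 hq
                exact mul_le_mul_of_nonneg_left (by linarith) hM.le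
        have hsq : 0 ≤ c s * (b - M * q * β) ^ 2 := by positivity
        exact add_nonneg (by positivity) (mul_nonneg (by linarith) (sq_nonneg y))
      have hid : 2 * (M * q) * (z - β * y + β * y) * (y - β * (b * y + c s * q * (z - β * y)))
            - 2 * y * (b * y + c s * q * (z - β * y))
          = -(2 * β / M) * (c s * (M * (q * z) + (b - M * q * β) * y / 2) ^ 2
          + (M * (b ^ 2 - c s * q) - c s * (b - M * q * β) ^ 2 / 4) * y ^ 2) := by
        have hbe : b = 1 / β := by field_simp; linarith
        rw [hbe]
        field_simp
        ring
      rw [hid]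
      have : 0 ≤ 2 * β / M := by positivity
      nlinarith [mul_nonneg this hform]) t ht
  simp only [zero_mul, Real.exp_zero, mul_one] at key
  set G := M * q * (u 0 + β * v 0) ^ 2 + v 0 ^ 2 with hG
  have hG0 : G ≤ (2 * M + 3) * (q * u 0 ^ 2 + v 0 ^ 2) := by
    have e1 : (u 0 + β * v 0) ^ 2 ≤ 2 * u 0 ^ 2 + 2 * (β ^ 2 * v 0 ^ 2) := by
      nlinarith [sq_nonneg (u 0 - β * v 0)]
    have e2 := mul_le_mul_of_nonneg_left e1 (by positivity : 0 ≤ M * q)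
    have e3 := mul_le_mul_of_nonneg_right hMqβ (sq_nonneg (v 0))
    have e4 : 0 ≤ q * u 0 ^ 2 := by positivity
    have e5 : 0 ≤ M * v 0 ^ 2 := by positivity
    nlinarith
  have hz : M * q * (u t + β * v t) ^ 2 ≤ G := by nlinarith [sq_nonneg (v t)]
  have hv : v t ^ 2 ≤ G := by
    have : 0 ≤ M * q * (u t + β * v t) ^ 2 := by positivity
    linarith
  have hu : q * u t ^ 2 ≤ 4 / M * G := by
    have e1 : u t ^ 2 ≤ 2 * (u t + β * v t) ^ 2 + 2 * (β ^ 2 * v t ^ 2) := by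
      nlinarith [sq_nonneg (u t + 2 * (β * v t))]
    have e2 := mul_le_mul_of_nonneg_left e1 (by positivity : 0 ≤ M * q)
    have e3 := mul_le_mul_of_nonneg_right hMqβ (sq_nonneg (v t))
    rw [div_mul_eq_mul_div, le_div_iff₀ hM]
    nlinarith
  calc v t ^ 2 + q * u t ^ 2 ≤ (1 + 4 / M) * G := by linarith
    _ ≤ (1 + 4 / M) * ((2 * M + 3) * (q * u 0 ^ 2 + v 0 ^ 2)) :=
      mul_le_mul_of_nonneg_left hG0 (by positivity)
    _ = _ := by ring

/-- Two modes with the same data differ by at most the `L¹` distance of the forcing terms, up to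
an exponential factor. -/
lemma dist_le {d u' v' : ℝ → ℝ} (h : IsModeSol b q T c u v) (h' : IsModeSol b q T d u' v')
    (hT : 0 ≤ T) (hq : 0 ≤ q) (hb0 : 0 ≤ b) (hM : 0 ≤ M) (hu : u 0 = u' 0) (hv : v 0 = v' 0)
    (hc : AEMeasurable c (volume.restrict (Icc 0 T))) (hcb : ∀ t ∈ Icc 0 T, |c t| ≤ M)
    (hd : AEMeasurable d (volume.restrict (Icc 0 T))) (hdb : ∀ t ∈ Icc 0 T, |d t| ≤ M) :
    ∀ t ∈ Icc 0 T, |v' t - v t| + |u' t - u t|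
      ≤ (∫ s in (0 : ℝ)..T, |(d s - c s) * (q * u' s)|) * Real.exp ((b + 1 + M * q) * T) := by
  have hK : 0 ≤ b + 1 + M * q := by positivity
  have hy : ContinuousOn (fun s => v' s - v s) (Icc 0 T) :=
    h'.continuousOn_vel.sub h.continuousOn_vel
  have hw : ContinuousOn (fun s => u' s - u s) (Icc 0 T) :=
    h'.continuousOn_pos.sub h.continuousOn_pos
  have hsum : ContinuousOn (fun s => |v' s - v s| + |u' s - u s|) (Icc 0 T) := hy.abs.add hw.abs
  have hdc : IntervalIntegrable (fun s => (d s - c s) * (q * u' s)) volume 0 T :=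
    intervalIntegrable_mul_of_bounded (M := M + M) hT (hd.sub hc)
      (fun t ht => (abs_sub _ _).trans (add_le_add (hdb t ht) (hcb t ht)))
      (h'.continuousOn_pos.const_mul q)
  have e0 : 0 ≤ ∫ s in (0 : ℝ)..T, |(d s - c s) * (q * u' s)| :=
    intervalIntegral.integral_nonneg hT fun _ _ => abs_nonneg _
  have key : ∀ t ∈ Icc 0 T, |v' t - v t| + |u' t - u t|
      ≤ (∫ s in (0 : ℝ)..T, |(d s - c s) * (q * u' s)|)
        + (b + 1 + M * q) * ∫ s in (0 : ℝ)..t, (|v' s - v s| + |u' s - u s|) := by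
    intro t ht
    have hsub : Icc 0 t ⊆ Icc 0 T := Icc_subset_Icc_right ht.2
    have husub : uIcc 0 t ⊆ uIcc 0 T := by rwa [uIcc_of_le ht.1, uIcc_of_le hT]
    have ii {f : ℝ → ℝ} (hf : ContinuousOn f (Icc 0 T)) : IntervalIntegrable f volume 0 t :=
      ContinuousOn.intervalIntegrable (by rw [uIcc_of_le ht.1]; exact hf.mono hsub)
    have hF := (h.intervalIntegrable_force hT hc hcb).mono_set husub
    have hF' := (h'.intervalIntegrable_force hT hd hdb).mono_set husub
    have hdt := hdc.mono_set husub
    have i1 : IntervalIntegrable (fun s => b * |v' s - v s| + M * q * |u' s - u s|) volume 0 t :=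
      ii ((hy.abs.const_mul b).add (hw.abs.const_mul (M * q)))
    have ey : v' t - v t = ∫ s in (0 : ℝ)..t,
        ((b * v s + c s * q * u s) - (b * v' s + d s * q * u' s)) := by
      rw [intervalIntegral.integral_sub hF hF', h.vel_eq t ht, h'.vel_eq t ht, hv]; ring
    have ew : u' t - u t = ∫ s in (0 : ℝ)..t, (v' s - v s) := by
      rw [intervalIntegral.integral_sub (ii h'.continuousOn_vel) (ii h.continuousOn_vel),
        h.pos_eq t ht, h'.pos_eq t ht, hu]; ring
    have by1 : |v' t - v t| ≤ ∫ s in (0 : ℝ)..t,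
        (b * |v' s - v s| + M * q * |u' s - u s| + |(d s - c s) * (q * u' s)|) := by
      rw [ey]
      refine (intervalIntegral.abs_integral_le_integral_abs ht.1).trans
        (intervalIntegral.integral_mono_on ht.1 (hF.sub hF').abs
          (i1.add hdt.abs) ?_)
      intro s hs
      have hcs := hcb s (hsub hs)
      calc |b * v s + c s * q * u s - (b * v' s + d s * q * u' s)|
          = |b * (v' s - v s) + c s * (q * (u' s - u s)) + (d s - c s) * (q * u' s)| := by
            rw [← abs_neg]; congr 1; ring
        _ ≤ |b * (v' s - v s)| + |c s * (q * (u' s - u s))| + |(d s - c s) * (q * u' s)| :=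
            abs_add_three _ _ _
        _ ≤ _ := by
            rw [abs_mul b, abs_mul (c s), abs_mul q, abs_of_nonneg hb0, abs_of_nonneg hq, mul_assoc]
            gcongr
    have bw1 : |u' t - u t| ≤ ∫ s in (0 : ℝ)..t, |v' s - v s| := by
      rw [ew]; exact intervalIntegral.abs_integral_le_integral_abs ht.1
    have hdle : ∫ s in (0 : ℝ)..t, |(d s - c s) * (q * u' s)|
        ≤ ∫ s in (0 : ℝ)..T, |(d s - c s) * (q * u' s)| :=
      intervalIntegral.integral_mono_interval le_rfl ht.1 ht.2
        (Eventually.of_forall fun _ => abs_nonneg _) hdc.abs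
    have hmono : (∫ s in (0 : ℝ)..t, (b * |v' s - v s| + M * q * |u' s - u s|))
          + ∫ s in (0 : ℝ)..t, |v' s - v s|
        ≤ ∫ s in (0 : ℝ)..t, (b + 1 + M * q) * (|v' s - v s| + |u' s - u s|) := by
      have i2 := ii hy.abs
      rw [← intervalIntegral.integral_add i1 i2]
      refine intervalIntegral.integral_mono_on ht.1 (i1.add i2)
        (ii (hsum.const_mul _)) fun s _ => ?_
      have := abs_nonneg (v' s - v s)
      have := abs_nonneg (u' s - u s)
      have : 0 ≤ M * q := by positivity
      nlinarith
    rw [intervalIntegral.integral_add i1 hdt.abs] at by1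
    rw [intervalIntegral.integral_const_mul] at hmono
    linarith
  intro t ht
  refine (le_mul_exp_of_le_add_integral hT hK hsum key t ht).trans ?_
  gcongr
  exact ht.2

end IsModeSol

lemma L2Cont.continuousOn_coord {I : Set ℝ} {v : ℝ → ℕ → ℝ} (h : L2Cont I v) (k : ℕ) :
    ContinuousOn (fun t => v t k) I := by
  rw [Metric.continuousOn_iff]
  intro t ht ε hε
  obtain ⟨η, hη, hs⟩ := h.2 t ht (ε ^ 2) (by positivity)
  refine ⟨η, hη, fun s hsI hst => ?_⟩
  have hsm : Summable fun k => (v s k - v t k) ^ 2 := by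
    refine Summable.of_nonneg_of_le (fun _ => sq_nonneg _) (fun k => ?_)
      (((h.1 s hsI).mul_left 2).add ((h.1 t ht).mul_left 2))
    nlinarith [sq_nonneg (v s k + v t k)]
  have := (hsm.le_tsum k fun _ _ => sq_nonneg _).trans_lt (hs s hsI hst)
  rw [Real.dist_eq]
  exact abs_lt_of_sq_lt_sq this hε.le

lemma IsLinearSol.isModeSol {lam : ℕ → ℝ} {c : ℝ → ℝ} {σ δ T : ℝ} {u0 u1 : ℕ → ℝ}
    {u v : ℕ → ℝ → ℝ} (h : IsLinearSol lam c σ δ T u0 u1 u v) (k : ℕ) :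
    IsModeSol (2 * δ * lam k ^ (2 * σ)) (lam k ^ 2) T c (u k) (v k) where
  hasDeriv := h.2.2.1 k
  continuousOn_vel := h.2.2.2.2.2.2.continuousOn_coord k
  vel_eq := by rw [h.2.1 k]; exact h.2.2.2.1 k

/-- In the supercritical and critical cases every mode is either low-frequency or overdamped. -/
lemma exists_frequency_threshold {μ σ δ : ℝ} (hδ : 0 < δ)
    (hcase : 1 / 2 < σ ∨ (σ = 1 / 2 ∧ μ ≤ 4 * δ ^ 2)) :
    ∃ M > 0, μ ≤ M ∧ ∃ L ≥ (0 : ℝ), ∀ l : ℝ, 0 ≤ l →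
      l ≤ L ∨ (0 < l ∧ M * l ^ 2 ≤ (2 * δ * l ^ (2 * σ)) ^ 2) := by
  rcases hcase with hσ | ⟨rfl, hμ⟩
  · refine ⟨max μ 1, by positivity, le_max_left _ _, ?_⟩
    set M := max μ 1
    have hM : 0 < M := by positivity
    have hp : 0 < 4 * σ - 2 := by linarith
    set L := (M / (4 * δ ^ 2)) ^ (1 / (4 * σ - 2)) with hL
    have hL0 : 0 ≤ L := by positivity
    refine ⟨L, hL0, fun l _ => (le_or_gt l L).imp id fun hlL => ?_⟩
    have hl : 0 < l := hL0.trans_lt hlL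
    refine ⟨hl, ?_⟩
    have hLp : L ^ (4 * σ - 2) = M / (4 * δ ^ 2) := by
      rw [hL, ← Real.rpow_mul (by positivity), one_div_mul_cancel hp.ne', Real.rpow_one]
    have h1 : M / (4 * δ ^ 2) ≤ l ^ (4 * σ - 2) :=
      hLp ▸ Real.rpow_le_rpow hL0 hlL.le hp.le
    rw [div_le_iff₀ (by positivity)] at h1
    have h2 : (l ^ (2 * σ)) ^ 2 = l ^ (4 * σ - 2) * l ^ 2 := by
      rw [← Real.rpow_natCast, ← Real.rpow_mul hl.le, ← Real.rpow_natCast l 2,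
        ← Real.rpow_add hl]
      congr 1; push_cast; ring
    calc M * l ^ 2 ≤ l ^ (4 * σ - 2) * (4 * δ ^ 2) * l ^ 2 :=
          mul_le_mul_of_nonneg_right h1 (sq_nonneg l)
      _ = _ := by rw [mul_pow, h2]; ring
  · refine ⟨4 * δ ^ 2, by positivity, hμ, 0, le_rfl, fun l hl => ?_⟩
    refine hl.eq_or_lt.imp (fun h => h.symm.le) fun h => ⟨h, ?_⟩
    rw [show (2 : ℝ) * (1 / 2) = 1 by norm_num, Real.rpow_one]
    exact le_of_eq (by ring)

/-- Energy bound uniform over all modes and all coefficients in the admissible class. -/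
lemma exists_uniform_energy_bound_s3 {μ σ δ T : ℝ} {lam : ℕ → ℝ} (hlam : ∀ k, 0 ≤ lam k)
    (hT : 0 ≤ T) (hδ : 0 < δ) (hcase : 1 / 2 < σ ∨ (σ = 1 / 2 ∧ μ ≤ 4 * δ ^ 2)) :
    ∃ C, ∀ (c : ℝ → ℝ) (u0 u1 : ℕ → ℝ) (u v : ℕ → ℝ → ℝ),
      AEMeasurable c (volume.restrict (Icc 0 T)) → (∀ t ∈ Icc (0 : ℝ) T, 0 ≤ c t ∧ c t ≤ μ) →
      IsLinearSol lam c σ δ T u0 u1 u v → ∀ k, ∀ t ∈ Icc (0 : ℝ) T,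
        v k t ^ 2 + lam k ^ 2 * u k t ^ 2 ≤ C * (lam k ^ 2 * u0 k ^ 2 + u1 k ^ 2) := by
  obtain ⟨M, hM, hμM, L, hL, hfreq⟩ := exists_frequency_threshold hδ hcase
  refine ⟨max (Real.exp (L * (1 + M) * T)) ((1 + 4 / M) * (2 * M + 3)), ?_⟩
  intro c u0 u1 u v hc hb hs k t ht
  have hb' : ∀ t ∈ Icc (0 : ℝ) T, 0 ≤ c t ∧ c t ≤ M :=
    fun t ht => ⟨(hb t ht).1, (hb t ht).2.trans hμM⟩
  have hk := hlam k
  have hdata : 0 ≤ lam k ^ 2 * u0 k ^ 2 + u1 k ^ 2 := by positivity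
  have hm := hs.isModeSol k
  rcases hfreq _ hk with hlow | ⟨hpos, hover⟩
  · refine (hm.low_bound hT hk (by positivity) hM.le hc hb' t ht).trans ?_
    rw [hs.1, hs.2.1]
    refine mul_le_mul_of_nonneg_right (le_max_of_le_left ?_) hdata
    gcongr
  · refine (hm.high_bound hT (by positivity) (by positivity) hM hover hc hb' t ht).trans ?_
    rw [hs.1, hs.2.1]
    exact mul_le_mul_of_nonneg_right (le_max_right _ _) hdata

lemma tendsto_integral_abs_coeff_diff {T M : ℝ} {c : ℕ → ℝ → ℝ} {d f : ℝ → ℝ} (hT : 0 ≤ T)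
    (hc : ∀ n, AEMeasurable (c n) (volume.restrict (Icc 0 T)))
    (hcb : ∀ n, ∀ t ∈ Icc 0 T, |c n t| ≤ M)
    (hd : AEMeasurable d (volume.restrict (Icc 0 T))) (hdb : ∀ t ∈ Icc 0 T, |d t| ≤ M)
    (hconv : ∀ t ∈ Icc 0 T, Tendsto (fun n => c n t) atTop (𝓝 (d t)))
    (hf : ContinuousOn f (Icc 0 T)) :
    Tendsto (fun n => ∫ s in (0 : ℝ)..T, |(d s - c n s) * f s|) atTop (𝓝 0) := by
  have hsub : uIoc 0 T ⊆ Icc 0 T := by rw [uIoc_of_le hT]; exact Ioc_subset_Icc_self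
  have h := intervalIntegral.tendsto_integral_filter_of_dominated_convergence
    (μ := volume) (a := 0) (b := T) (l := atTop) (f := fun _ => (0 : ℝ))
    (F := fun n s => |(d s - c n s) * f s|) (fun s => (M + M) * |f s|)
    (Eventually.of_forall fun n => ?_) (Eventually.of_forall fun n => ?_) ?_ ?_
  · simpa using h
  · exact ((intervalIntegrable_mul_of_bounded (M := M + M) hT (hd.sub (hc n))
      (fun t ht => (abs_sub _ _).trans (add_le_add (hdb t ht) (hcb n t ht)))
      hf).abs).aestronglyMeasurable_restrict_uIoc
  · refine Eventually.of_forall fun s hs => ?_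
    rw [Real.norm_eq_abs, abs_abs, abs_mul]
    exact mul_le_mul_of_nonneg_right ((abs_sub _ _).trans
      (add_le_add (hdb s (hsub hs)) (hcb n s (hsub hs)))) (abs_nonneg _)
  · exact ContinuousOn.intervalIntegrable (by
      rw [uIcc_of_le hT]; exact hf.abs.const_mul _)
  · refine Eventually.of_forall fun s hs => ?_
    simpa using (((hconv s (hsub hs)).const_sub (d s)).mul_const (f s)).abs

/-- Convergence of solutions of linear problems in the supercritical case: if the
coefficients `c n` converge pointwise to `c∞`, then the solutions converge uniformly
in the energy space. -/
theorem convergence_supercritical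
    (T : ℝ) (hT : 0 < T) (lam : ℕ → ℝ) (hlam : ∀ k, 0 ≤ lam k)
    (μ₂ : ℝ) (c : ℕ → ℝ → ℝ) (cinf : ℝ → ℝ)
    (hmeas : ∀ n, AEMeasurable (c n) (volume.restrict (Icc 0 T)))
    (hbd : ∀ n, ∀ t ∈ Icc (0:ℝ) T, 0 ≤ c n t ∧ c n t ≤ μ₂)
    (hconv : ∀ t ∈ Icc (0:ℝ) T, Tendsto (fun n => c n t) atTop (𝓝 (cinf t)))
    (σ δ : ℝ) (hσ : 0 < σ) (hδ : 0 < δ)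
    (hcase : 1 / 2 < σ ∨ (σ = 1 / 2 ∧ μ₂ ≤ 4 * δ ^ 2))
    (u0 u1 : ℕ → ℝ)
    (hu0 : Summable fun k => u0 k ^ 2)
    (hu0' : Summable fun k => lam k ^ 2 * u0 k ^ 2)
    (hu1 : Summable fun k => u1 k ^ 2)
    (u v : ℕ → ℕ → ℝ → ℝ) (uinf vinf : ℕ → ℝ → ℝ)
    (hsol : ∀ n, IsLinearSol lam (c n) σ δ T u0 u1 (u n) (v n))
    (hsolinf : IsLinearSol lam cinf σ δ T u0 u1 uinf vinf) :
    ∀ ε : ℝ, 0 < ε → ∃ N : ℕ, ∀ n ≥ N, ∀ t ∈ Icc (0:ℝ) T,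
      (∑' k, (vinf k t - v n k t) ^ 2) +
        (∑' k, lam k ^ 2 * (uinf k t - u n k t) ^ 2) < ε := by
  have hT0 := hT.le
  have hcb : ∀ n, ∀ t ∈ Icc (0 : ℝ) T, |c n t| ≤ μ₂ :=
    fun n t ht => abs_le.2 ⟨by linarith [(hbd n t ht).1, (hbd n t ht).2], (hbd n t ht).2⟩
  have hbdinf : ∀ t ∈ Icc (0 : ℝ) T, 0 ≤ cinf t ∧ cinf t ≤ μ₂ := fun t ht =>
    ⟨ge_of_tendsto' (hconv t ht) fun n => (hbd n t ht).1,
      le_of_tendsto' (hconv t ht) fun n => (hbd n t ht).2⟩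
  have hcbinf : ∀ t ∈ Icc (0 : ℝ) T, |cinf t| ≤ μ₂ :=
    fun t ht => abs_le.2 ⟨by linarith [(hbdinf t ht).1, (hbdinf t ht).2], (hbdinf t ht).2⟩
  have hμ : 0 ≤ μ₂ := (hbdinf 0 ⟨le_rfl, hT0⟩).1.trans (hbdinf 0 ⟨le_rfl, hT0⟩).2
  have hmeasinf : AEMeasurable cinf (volume.restrict (Icc 0 T)) := by
    refine aemeasurable_of_tendsto_metrizable_ae atTop hmeas ?_
    rw [ae_restrict_iff' measurableSet_Icc]
    exact Eventually.of_forall hconv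
  obtain ⟨C, hC⟩ := exists_uniform_energy_bound_s3 (μ := μ₂) hlam hT0 hδ hcase
  set D : ℕ → ℝ := fun k => 4 * (C * (lam k ^ 2 * u0 k ^ 2 + u1 k ^ 2)) with hD
  have hDsum : Summable D := ((hu0'.add hu1).mul_left C).mul_left 4
  set B : ℕ → ℕ → ℝ := fun n k => (1 + lam k ^ 2) *
    ((∫ s in (0 : ℝ)..T, |(cinf s - c n s) * (lam k ^ 2 * uinf k s)|) *
      Real.exp ((2 * δ * lam k ^ (2 * σ) + 1 + μ₂ * lam k ^ 2) * T)) ^ 2 with hB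
  have hB0 : ∀ n k, 0 ≤ B n k := fun n k => by positivity
  have hBlim : ∀ k, Tendsto (fun n => B n k) atTop (𝓝 0) := fun k => by
    have hI := tendsto_integral_abs_coeff_diff hT0 hmeas hcb hmeasinf hcbinf hconv
      ((hsolinf.isModeSol k).continuousOn_pos.const_mul (lam k ^ 2))
    have := ((hI.mul_const (Real.exp ((2 * δ * lam k ^ (2 * σ) + 1 + μ₂ * lam k ^ 2) * T))).pow
      2).const_mul (1 + lam k ^ 2)
    rwa [zero_mul, zero_pow two_ne_zero, mul_zero] at this
  have hED : ∀ n k, ∀ t ∈ Icc (0 : ℝ) T,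
      (vinf k t - v n k t) ^ 2 + lam k ^ 2 * (uinf k t - u n k t) ^ 2 ≤ D k := by
    intro n k t ht
    have h1 := hC _ _ _ _ _ (hmeas n) (hbd n) (hsol n) k t ht
    have h2 := hC _ _ _ _ _ hmeasinf hbdinf hsolinf k t ht
    have h3 : (uinf k t - u n k t) ^ 2 ≤ 2 * uinf k t ^ 2 + 2 * u n k t ^ 2 := by
      nlinarith [sq_nonneg (uinf k t + u n k t)]
    have h4 := mul_le_mul_of_nonneg_left h3 (sq_nonneg (lam k))
    simp only [hD]
    nlinarith [sq_nonneg (vinf k t + v n k t)]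
  have hEB : ∀ n k, ∀ t ∈ Icc (0 : ℝ) T,
      (vinf k t - v n k t) ^ 2 + lam k ^ 2 * (uinf k t - u n k t) ^ 2 ≤ B n k := by
    intro n k t ht
    have hk := hlam k
    have h := ((hsol n).isModeSol k).dist_le (hsolinf.isModeSol k) hT0 (by positivity)
      (by positivity) hμ (by rw [(hsol n).1, hsolinf.1]) (by rw [(hsol n).2.1, hsolinf.2.1])
      (hmeas n) (hcb n) hmeasinf hcbinf t ht
    have hv := pow_le_pow_left₀ (abs_nonneg _)
      ((le_add_of_nonneg_right (abs_nonneg (uinf k t - u n k t))).trans h) 2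
    have hu := pow_le_pow_left₀ (abs_nonneg _)
      ((le_add_of_nonneg_left (abs_nonneg (vinf k t - v n k t))).trans h) 2
    rw [sq_abs] at hv hu
    have := mul_le_mul_of_nonneg_left hu (sq_nonneg (lam k))
    simp only [hB]
    linarith
  have hD0 : ∀ k, 0 ≤ D k := fun k =>
    le_trans (by positivity) (hED 0 k 0 ⟨le_rfl, hT0⟩)
  have hmin0 : ∀ n k, 0 ≤ min (D k) (B n k) := fun n k => le_min (hD0 k) (hB0 n k)
  have hlim : Tendsto (fun n => ∑' k, min (D k) (B n k)) atTop (𝓝 0) := by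
    have := tendsto_tsum_of_dominated_convergence (𝓕 := atTop) (g := fun _ : ℕ => (0 : ℝ))
      (f := fun n k => min (D k) (B n k)) hDsum
      (fun k => squeeze_zero (fun n => hmin0 n k) (fun n => min_le_right _ _) (hBlim k))
      (Eventually.of_forall fun n k => by
        rw [Real.norm_of_nonneg (hmin0 n k)]; exact min_le_left _ _)
    simpa using this
  intro ε hε
  obtain ⟨N, hN⟩ := eventually_atTop.1 (hlim.eventually_lt_const hε)
  refine ⟨N, fun n hn t ht => lt_of_le_of_lt ?_ (hN n hn)⟩
  have hy0 : ∀ k, 0 ≤ (vinf k t - v n k t) ^ 2 := fun k => sq_nonneg _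
  have hw0 : ∀ k, 0 ≤ lam k ^ 2 * (uinf k t - u n k t) ^ 2 := fun k => by positivity
  have hy : Summable fun k => (vinf k t - v n k t) ^ 2 :=
    hDsum.of_nonneg_of_le hy0 fun k => by linarith [hED n k t ht, hw0 k]
  have hw : Summable fun k => lam k ^ 2 * (uinf k t - u n k t) ^ 2 :=
    hDsum.of_nonneg_of_le hw0 fun k => by linarith [hED n k t ht, hy0 k]
  rw [← hy.tsum_add hw]
  exact (hy.add hw).tsum_le_tsum (fun k => le_min (hED n k t ht) (hEB n k t ht))
    (hDsum.of_nonneg_of_le (hmin0 n) fun k => min_le_left _ _)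
end
end
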